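/- arXiv:2406.00643 — 11 statements merged into one kernel-verified Lean document; each statement's English description precedes it below -/
import Mathlib

section
/- Let G be a finite simple graph and u a vertex of G, and let t = Γ_G(u) be the maximum integer such that some Grundy coloring of G assigns color t to u. Then for every integer j with 1 ≤ j ≤ t there exists a Grundy coloring of G in which u receives color j; that is, the set A_G(u) of colors that u can receive in a Grundy coloring of G equals {1, 2, …, t}. -/
open SimpleGraph

variable {V : Type*}

/-- A Grundy (First-Fit) coloring of `G` with `k` colors: a proper coloring with colors
`1, …, k`, all color classes nonempty, such that every vertex of color `j` has a neighbor
of each color `i < j` (with `i ≥ 1`). -/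
def IsGrundyColoring (G : SimpleGraph V) (c : V → ℕ) (k : ℕ) : Prop :=
  (∀ v, c v ∈ Finset.Icc 1 k) ∧
  (∀ ⦃x y⦄, G.Adj x y → c x ≠ c y) ∧
  (∀ i ∈ Finset.Icc 1 k, ∃ v, c v = i) ∧
  (∀ v, ∀ i ∈ Finset.Ico 1 (c v), ∃ w, G.Adj v w ∧ c w = i)

/-- The Grundy (First-Fit) chromatic number `Γ(G)`. -/
noncomputable def grundyNumber (G : SimpleGraph V) : ℕ :=
  sSup {k | ∃ c, IsGrundyColoring G c k}

/-- `Γ_G(u)`: the largest color that `u` can receive in a Grundy coloring of `G`. -/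
noncomputable def grundyAt (G : SimpleGraph V) (u : V) : ℕ :=
  sSup {j | ∃ c k, IsGrundyColoring G c k ∧ c u = j}

/-- `v` is a cut-vertex of `G`: deleting `v` disconnects (for connected `G`, increases the
number of connected components). -/
def IsCutVertex (G : SimpleGraph V) (v : V) : Prop :=
  ¬ (G.induce {w | w ≠ v}).Connected

/-- A block of `G`: a maximal vertex set of size at least two inducing a connected subgraph
with no cut-vertex (i.e. a maximal 2-connected subgraph or a bridge with its endpoints). -/
def IsBlock (G : SimpleGraph V) (B : Set V) : Prop :=
  Maximal (fun A : Set V => 2 ≤ A.ncard ∧ (G.induce A).Connected ∧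
    ∀ v ∈ A, (G.induce (A \ {v})).Connected) B

/-- A block graph: a connected graph every block of which is complete. -/
def IsBlockGraph (G : SimpleGraph V) : Prop :=
  G.Connected ∧ ∀ B : Set V, IsBlock G B → ∀ u ∈ B, ∀ v ∈ B, u ≠ v → G.Adj u v

/-- The number of blocks of `G` containing `v` (the degree of a cut-vertex `v` in the
block-cutpoint graph). -/
noncomputable def blockDegree (G : SimpleGraph V) (v : V) : ℕ :=
  {B : Set V | IsBlock G B ∧ v ∈ B}.ncard

/-- `Δ̃(G)`: the maximum over all cut-vertices `v` of the number of blocks containing `v`. -/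
noncomputable def maxCutBlockDegree (G : SimpleGraph V) : ℕ :=
  sSup {n | ∃ v, IsCutVertex G v ∧ blockDegree G v = n}

/-- The ball `B(u, r)` of radius `r` centered at `u`. -/
def gball (G : SimpleGraph V) (u : V) (r : ℕ) : Set V :=
  {v | G.Reachable u v ∧ G.dist u v ≤ r}

lemma mem_gball_self (G : SimpleGraph V) (u : V) (r : ℕ) : u ∈ gball G u r :=
  ⟨Reachable.refl u, by simp [SimpleGraph.dist_self]⟩

/-- The degree of a vertex. -/
noncomputable def deg (G : SimpleGraph V) (v : V) : ℕ := (G.neighborSet v).ncard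

/-- `Δ(u) = max {d(v) : v ∈ N(u), d(v) ≤ d(u)}`, equal to `0` if no such neighbor exists. -/
noncomputable def maxSmallNbrDeg (G : SimpleGraph V) (u : V) : ℕ :=
  sSup {d | ∃ v, G.Adj u v ∧ deg G v ≤ deg G u ∧ deg G v = d}

/-- `Δ₂(G) = max_{u} Δ(u)`. -/
noncomputable def delta2 (G : SimpleGraph V) : ℕ :=
  sSup {d | ∃ u, maxSmallNbrDeg G u = d}

/-- The maximum number of vertices of a block of `G`. -/
noncomputable def maxBlockSize (G : SimpleGraph V) : ℕ :=
  sSup {n | ∃ B, IsBlock G B ∧ B.ncard = n}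

/-- A partial Grundy coloring, where color `0` means uncolored. -/
def PartialGrundy (G : SimpleGraph V) (c : V → ℕ) : Prop :=
  (∀ x y, G.Adj x y → c x ≠ 0 → c x ≠ c y) ∧
  (∀ v i, 1 ≤ i → i < c v → ∃ w, G.Adj v w ∧ c w = i)

lemma PartialGrundy.extend [Fintype V] (G : SimpleGraph V) :
    ∀ (n : ℕ) (c : V → ℕ), PartialGrundy G c → {v | c v = 0}.ncard = n →
      ∃ d, PartialGrundy G d ∧ (∀ v, d v ≠ 0) ∧ ∀ v, c v ≠ 0 → d v = c v := by
  classical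
  intro n
  induction n with
  | zero =>
    intro c hc h
    refine ⟨c, hc, fun v hv => ?_, fun _ _ => rfl⟩
    rw [Set.ncard_eq_zero (Set.toFinite _)] at h
    have : v ∈ {v | c v = 0} := hv
    rw [h] at this
    exact this
  | succ n ih =>
    intro c hc h
    obtain ⟨v, hv⟩ : {v | c v = 0}.Nonempty := by
      rw [← Set.ncard_pos (Set.toFinite _)]; omega
    have hv0 : c v = 0 := hv
    have hex : ∃ i, 1 ≤ i ∧ ∀ w, G.Adj v w → c w ≠ i := by
      refine ⟨(∑ w, c w) + 1, by omega, fun w _ => ?_⟩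
      have := Finset.single_le_sum (f := c) (fun _ _ => Nat.zero_le _) (Finset.mem_univ w)
      omega
    obtain ⟨m1, m2⟩ := Nat.find_spec hex
    have m3 : ∀ i < Nat.find hex, _ := fun i hi => Nat.find_min hex hi
    generalize Nat.find hex = m at m1 m2 m3
    have hset : {x | Function.update c v m x = 0} = {x | c x = 0} \ {v} := by
      ext x
      by_cases hx : x = v
      · subst hx; simp; omega
      · simp [hx]
    have hP : PartialGrundy G (Function.update c v m) := by
      constructor
      · intro x y hxy hx
        by_cases h1 : x = v
        · subst h1
          have hne : y ≠ x := hxy.ne'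
          simpa [hne] using (m2 y hxy).symm
        · by_cases h2 : y = v
          · subst h2
            simpa [h1] using m2 x hxy.symm
          · simp only [Function.update_of_ne h1, Function.update_of_ne h2] at hx ⊢
            exact hc.1 x y hxy hx
      · intro x i hi hix
        obtain ⟨w, hw, hwi⟩ : ∃ w, G.Adj x w ∧ c w = i := by
          by_cases h1 : x = v
          · subst h1
            simp only [Function.update_self] at hix
            have := m3 i hix
            push Not at this
            exact this hi
          · simp only [Function.update_of_ne h1] at hix
            exact hc.2 x i hi hix
        have hwv : w ≠ v := by rintro rfl; omega
        exact ⟨w, hw, by simpa [hwv] using hwi⟩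
    have hN : {x | Function.update c v m x = 0}.ncard = n := by
      rw [hset, Set.ncard_diff_singleton_of_mem hv, h]; rfl
    obtain ⟨d, hd, hd0, hdc⟩ := ih (Function.update c v m) hP hN
    refine ⟨d, hd, hd0, fun x hx => ?_⟩
    have hxv : x ≠ v := by rintro rfl; exact hx hv0
    have := hdc x (by simpa [hxv] using hx)
    simpa [hxv] using this

lemma PartialGrundy.exists_grundy [Fintype V] (G : SimpleGraph V) (u : V) (c : V → ℕ)
    (hc : PartialGrundy G c) :
    ∃ d k, IsGrundyColoring G d k ∧ ∀ v, c v ≠ 0 → d v = c v := by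
  obtain ⟨d, hd, hd0, hdc⟩ := PartialGrundy.extend G _ c hc rfl
  obtain ⟨x, -, hx⟩ := Finset.exists_max_image Finset.univ d ⟨u, Finset.mem_univ u⟩
  refine ⟨d, d x, ⟨fun v => ?_, fun a b hab => hd.1 a b hab (hd0 a), fun i hi => ?_,
    fun v i hi => ?_⟩, hdc⟩
  · exact Finset.mem_Icc.2 ⟨Nat.one_le_iff_ne_zero.2 (hd0 v), hx v (Finset.mem_univ v)⟩
  · rw [Finset.mem_Icc] at hi
    rcases hi.2.eq_or_lt with h | h
    · exact ⟨x, h.symm⟩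
    · obtain ⟨w, -, hw⟩ := hd.2 x i hi.1 h
      exact ⟨w, hw⟩
  · rw [Finset.mem_Ico] at hi
    exact hd.2 v i hi.1 hi.2

/-- The set `A_G(u)` of colors that `u` can receive in a Grundy coloring of
`G` equals `{1, 2, …, Γ_G(u)}`. -/
theorem statement_0 [Fintype V] (G : SimpleGraph V) (u : V) :
    {j : ℕ | ∃ c k, IsGrundyColoring G c k ∧ c u = j} = Set.Icc 1 (grundyAt G u) := by
  classical
  have hbdd : BddAbove {j : ℕ | ∃ c k, IsGrundyColoring G c k ∧ c u = j} := by
    refine ⟨Fintype.card V, ?_⟩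
    rintro j ⟨c, k, hc, rfl⟩
    have h1 : Finset.Icc 1 k ⊆ Finset.univ.image c := by
      intro i hi
      obtain ⟨v, hv⟩ := hc.2.2.1 i hi
      exact Finset.mem_image.2 ⟨v, Finset.mem_univ v, hv⟩
    have h2 := (Finset.card_le_card h1).trans Finset.card_image_le
    have h3 := Finset.mem_Icc.1 (hc.1 u)
    simp only [Nat.card_Icc, Finset.card_univ] at h2
    omega
  have hne : {j : ℕ | ∃ c k, IsGrundyColoring G c k ∧ c u = j}.Nonempty := by
    obtain ⟨d, k, hd, -⟩ := PartialGrundy.exists_grundy G u (fun _ => 0)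
      ⟨fun _ _ _ h => absurd rfl h, fun _ _ _ h => absurd h (Nat.not_lt_zero _)⟩
    exact ⟨d u, d, k, hd, rfl⟩
  ext j
  constructor
  · intro hj
    refine ⟨?_, le_csSup hbdd hj⟩
    obtain ⟨c, k, hc, rfl⟩ := hj
    exact (Finset.mem_Icc.1 (hc.1 u)).1
  · rintro ⟨hj1, hj2⟩
    obtain ⟨c, k, hc, hcu⟩ := Nat.sSup_mem hne hbdd
    change c u = grundyAt G u at hcu
    have hP : PartialGrundy G (fun v => c v - (grundyAt G u - j)) := by
      refine ⟨fun x y hxy hx => ?_, fun v i hi hiv => ?_⟩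
      · have := hc.2.1 hxy
        simp only at hx ⊢
        omega
      · simp only at hiv
        obtain ⟨w, hw, hwi⟩ := hc.2.2.2 v (i + (grundyAt G u - j))
          (Finset.mem_Ico.2 ⟨by omega, by omega⟩)
        exact ⟨w, hw, by simp only; omega⟩
    obtain ⟨d, k', hd, hdc⟩ := PartialGrundy.exists_grundy G u _ hP
    refine ⟨d, k', hd, ?_⟩
    have := hdc u (by omega)
    omega
end

section
/- Let G be a connected block graph, let w be a cut-vertex of G, and let T be a spanning tree of G rooted at w such that d_T(w,v) = d_G(w,v) for every vertex v (a breadth-first search tree). Then a vertex v of G is NOT a cut-vertex of G if and only if v has degree exactly one in T. -/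
open SimpleGraph

variable {V : Type*}

lemma connected_induce_of_walks (G : SimpleGraph V) (S : Set V) (v : V) (hv : v ∈ S)
    (h : ∀ u ∈ S, ∃ q : G.Walk u v, ∀ x ∈ q.support, x ∈ S) : (G.induce S).Connected := by
  have key : ∀ u : S, (G.induce S).Reachable u ⟨v, hv⟩ := by
    rintro ⟨u, hu⟩
    obtain ⟨q, hq⟩ := h u hu
    exact ⟨q.induce S hq⟩
  exact (connected_iff _).mpr ⟨fun a b => (key a).trans (key b).symm, ⟨⟨v, hv⟩⟩⟩

/-- Two neighbours of `v` joined by a path avoiding `v` lie in a common block. -/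
lemma adj_of_path_avoiding [Finite V] (G : SimpleGraph V) (hBG : IsBlockGraph G)
    {v p c : V} (hp : G.Adj p v) (hc : G.Adj c v) (hpc : p ≠ c)
    (P : G.Walk p c) (hP : P.IsPath) (hvP : v ∉ P.support) : G.Adj p c := by
  classical
  let A : Set V := insert v {x | x ∈ P.support}
  have hpA : p ∈ A := Or.inr P.start_mem_support
  have hcA : c ∈ A := Or.inr P.end_mem_support
  have hA : 2 ≤ A.ncard ∧ (G.induce A).Connected ∧
      ∀ v ∈ A, (G.induce (A \ {v})).Connected := by
    refine ⟨?_, ?_, ?_⟩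
    · have : 1 < A.ncard := (Set.one_lt_ncard (Set.toFinite A)).mpr ⟨p, hpA, c, hcA, hpc⟩
      omega
    · apply connected_induce_of_walks G A v (Or.inl rfl)
      rintro u (rfl | hu)
      · exact ⟨Walk.nil, by simp [A]⟩
      · refine ⟨(P.takeUntil u hu).reverse.concat hp, ?_⟩
        intro x hx
        rw [Walk.support_concat] at hx
        simp only [Walk.support_reverse, List.concat_eq_append, List.mem_append,
          List.mem_reverse, List.mem_singleton] at hx
        rcases hx with hx | hx
        · exact Or.inr (P.support_takeUntil_subset_support hu hx)
        · exact Or.inl hx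
    · intro x hxA
      by_cases hxv : x = v
      · subst hxv
        have : A \ {x} = {y | y ∈ P.support} := by
          ext y
          simp only [A, Set.mem_diff, Set.mem_insert_iff, Set.mem_setOf_eq, Set.mem_singleton_iff]
          constructor
          · rintro ⟨h | h, h'⟩
            · exact absurd h h'
            · exact h
          · intro h
            exact ⟨Or.inr h, fun e => hvP (e ▸ h)⟩
        rw [this]
        exact P.connected_induce_support
      · apply connected_induce_of_walks G (A \ {x}) v ⟨Or.inl rfl, fun e => hxv (by simpa using e.symm)⟩
        rintro u ⟨rfl | hu, hux⟩
        · exact ⟨Walk.nil, by simp [A]; exact fun e => hxv e.symm⟩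
        · simp only [Set.mem_setOf_eq] at hu
          have hux : u ≠ x := hux
          by_cases hxt : x ∈ (P.takeUntil u hu).support
          · have hxd : x ∉ (P.dropUntil u hu).support := by
              intro hxd
              have hn := hP.support_nodup
              rw [← P.take_spec hu, Walk.support_append] at hn
              rw [Walk.mem_support_iff] at hxd
              rcases hxd with hxd | hxd
              · exact hux hxd.symm
              · exact (List.nodup_append.mp hn).2.2 x hxt x hxd rfl
            refine ⟨(P.dropUntil u hu).concat hc, ?_⟩
            intro y hy
            rw [Walk.support_concat] at hy
            simp only [List.concat_eq_append, List.mem_append, List.mem_singleton] at hy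
            rcases hy with hy | rfl
            · exact ⟨Or.inr (P.support_dropUntil_subset_support hu hy), fun e => hxd (e ▸ hy)⟩
            · exact ⟨Or.inl rfl, fun e => hxv e.symm⟩
          · refine ⟨(P.takeUntil u hu).reverse.concat hp, ?_⟩
            intro y hy
            rw [Walk.support_concat] at hy
            simp only [Walk.support_reverse, List.concat_eq_append, List.mem_append,
              List.mem_reverse, List.mem_singleton] at hy
            rcases hy with hy | rfl
            · exact ⟨Or.inr (P.support_takeUntil_subset_support hu hy), fun e => hxt (e ▸ hy)⟩
            · exact ⟨Or.inl rfl, fun e => hxv e.symm⟩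
  obtain ⟨B, hAB, hB⟩ := Set.Finite.exists_le_maximal
    (s := {A : Set V | 2 ≤ A.ncard ∧ (G.induce A).Connected ∧
      ∀ v ∈ A, (G.induce (A \ {v})).Connected}) (Set.toFinite _) hA
  exact hBG.2 B hB p (hAB hpA) c (hAB hcA) hpc

/-- In a tree, a neighbour of `v` no farther from the root than `v` is the parent of `v`. -/
lemma tree_parent_unique (T : SimpleGraph V) (hT : T.IsTree) {w v a b : V}
    (ha : T.Adj a v) (hb : T.Adj b v) (hda : T.dist w a ≤ T.dist w v)
    (hdb : T.dist w b ≤ T.dist w v) : a = b := by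
  classical
  have key : ∀ a, T.Adj a v → T.dist w a ≤ T.dist w v →
      ∃ q : T.Walk w v, q.IsPath ∧ q.penultimate = a := by
    intro a ha hda
    obtain ⟨q, hq, hql⟩ := hT.1.exists_path_of_dist w a
    refine ⟨q.concat ha, hq.concat ?_ ha, by simp⟩
    intro hv
    have h1 := dist_le (q.takeUntil v hv)
    have h2 := congrArg Walk.length (q.take_spec hv)
    rw [Walk.length_append] at h2
    have h3 : (q.dropUntil v hv).length ≠ 0 := fun h => ha.ne (Walk.eq_of_length_eq_zero h).symm
    omega
  obtain ⟨q, hq, rfl⟩ := key a ha hda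
  obtain ⟨r, hr, rfl⟩ := key b hb hdb
  have := hT.2.path_unique ⟨q, hq⟩ ⟨r, hr⟩
  rw [Subtype.mk.injEq] at this
  rw [this]

/-- In a connected block graph `G` with a BFS spanning tree `T` rooted at a
cut-vertex `w`, a vertex is not a cut-vertex of `G` iff it has degree exactly one in `T`. -/
theorem statement_1 [Fintype V] (G T : SimpleGraph V) (hBG : IsBlockGraph G)
    (w : V) (hw : IsCutVertex G w) (hle : T ≤ G) (hTree : T.IsTree)
    (hBFS : ∀ v, T.dist w v = G.dist w v) (v : V) :
    ¬ IsCutVertex G v ↔ (T.neighborSet v).ncard = 1 := by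
  classical
  constructor
  · intro hv
    have hconn : (G.induce {x | x ≠ v}).Connected := not_not.mp hv
    have hwv : w ≠ v := by
      rintro rfl
      exact hv hw
    obtain ⟨Q, hQ, hQl⟩ := hTree.1.exists_path_of_dist w v
    have hQn : ¬ Q.Nil := fun h => hwv h.eq
    have hpv : T.Adj Q.penultimate v := Q.adj_penultimate hQn
    have hdp : T.dist w Q.penultimate + 1 ≤ T.dist w v := by
      have h1 := dist_le Q.dropLast
      have h2 : Q.dropLast.length + 1 = Q.length := Q.length_dropLast_add_one hQn
      omega
    rw [Set.ncard_eq_one]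
    refine ⟨Q.penultimate, ?_⟩
    ext c
    simp only [mem_neighborSet, Set.mem_singleton_iff]
    constructor
    · intro hvc
      by_contra hne
      have hreach : (G.induce {x | x ≠ v}).Reachable ⟨Q.penultimate, hpv.ne⟩ ⟨c, hvc.ne.symm⟩ :=
        hconn.preconnected _ _
      obtain ⟨R, hR⟩ := hreach.exists_isPath
      let f : G.induce {x | x ≠ v} ↪g G := Embedding.induce _
      have hadj : G.Adj Q.penultimate c := by
        refine adj_of_path_avoiding G hBG (hle hpv) (hle hvc.symm) (Ne.symm hne)
          (R.map f.toHom) (Walk.map_isPath_of_injective f.injective hR) ?_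
        intro h
        have h' : v ∈ R.support.map f.toHom := (Walk.support_map f.toHom R) ▸ h
        obtain ⟨y, -, hy⟩ := List.mem_map.mp h'
        exact y.2 hy
      have hd : T.dist w c ≤ T.dist w v := by
        have h1 := hBG.1.dist_triangle (u := w) (v := Q.penultimate) (w := c)
        rw [dist_eq_one_iff_adj.mpr hadj, ← hBFS, ← hBFS] at h1
        omega
      exact hne (tree_parent_unique T hTree hvc.symm hpv hd (by omega))
    · rintro rfl
      exact hpv.symm
  · intro h
    refine not_not.mpr ?_
    have hdeg : T.degree v = 1 := by
      rw [← card_neighborSet_eq_degree, ← Nat.card_eq_fintype_card]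
      exact h
    have := hTree.1.induce_compl_singleton_of_degree_eq_one hdeg
    exact this.mono (fun a b hab => hle hab)
end

section
/- Let G be a connected block graph with at least one vertex. Then there exists a vertex w of G with Γ_G(w) = Γ(G); moreover, if Γ(G) > ω(G), then every vertex w satisfying Γ_G(w) = Γ(G) is a cut-vertex of G. -/
open SimpleGraph

variable {V : Type*}

lemma aux_block [Fintype V] (G : SimpleGraph V) {w a b : V} (p : G.Walk a b) (hp : p.IsPath)
    (hab : a ≠ b) (hw : w ∉ p.support) (ha : G.Adj w a) (hb : G.Adj w b) :
    ∃ B, IsBlock G B ∧ a ∈ B ∧ b ∈ B := by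
  classical
  let A : Set V := {x | x = w ∨ x ∈ p.support}
  have haA : a ∈ A := Or.inr p.start_mem_support
  have hbA : b ∈ A := Or.inr p.end_mem_support
  have hwA : w ∈ A := Or.inl rfl
  have key : 2 ≤ A.ncard ∧ (G.induce A).Connected ∧
      ∀ v ∈ A, (G.induce (A \ {v})).Connected := by
    refine ⟨?_, ?_, ?_⟩
    · have h1 : ({a, b} : Set V) ⊆ A := by
        rintro x (rfl | rfl) <;> assumption
      have h2 := Set.ncard_le_ncard h1 (Set.toFinite A)
      rwa [Set.ncard_pair hab] at h2
    · rw [connected_iff_exists_forall_reachable]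
      refine ⟨⟨w, hwA⟩, ?_⟩
      rintro ⟨x, hx⟩
      rcases id hx with rfl | hxp
      · exact Reachable.refl _
      · refine ⟨(Walk.cons ha (p.takeUntil x hxp)).induce A ?_⟩
        intro y hy
        rw [Walk.support_cons, List.mem_cons] at hy
        exact hy.imp id fun h => p.support_takeUntil_subset_support hxp h
    · intro v hv
      rw [connected_iff_exists_forall_reachable]
      by_cases hvw : v = w
      · subst hvw
        have hav : a ≠ v := ha.ne'
        refine ⟨⟨a, haA, hav⟩, ?_⟩
        rintro ⟨x, hx, hxv⟩
        rcases id hx with rfl | hxp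
        · exact absurd rfl hxv
        · refine ⟨(p.takeUntil x hxp).induce _ ?_⟩
          intro y hy
          have hy' := p.support_takeUntil_subset_support hxp hy
          refine ⟨Or.inr hy', ?_⟩
          rintro rfl
          exact hw hy'
      · refine ⟨⟨w, hwA, fun h => hvw h.symm⟩, ?_⟩
        rintro ⟨x, hx, hxv⟩
        rcases id hx with rfl | hxp
        · exact Reachable.refl _
        · by_cases hvt : v ∈ (p.takeUntil x hxp).support
          · have hvd : v ∉ (p.dropUntil x hxp).support := by
              intro hvd
              have hn := hp.support_nodup
              rw [← p.take_spec hxp, Walk.support_append] at hn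
              rw [Walk.mem_support_iff] at hvd
              rcases hvd with h | h
              · exact hxv h.symm
              · exact (List.nodup_append.1 hn).2.2 v hvt v h rfl
            refine ⟨(Walk.cons hb (p.dropUntil x hxp).reverse).induce _ ?_⟩
            intro y hy
            rw [Walk.support_cons, List.mem_cons, Walk.support_reverse, List.mem_reverse] at hy
            refine ⟨hy.imp id fun h => p.support_dropUntil_subset_support hxp h, ?_⟩
            rintro rfl
            exact hy.elim hvw hvd
          · refine ⟨(Walk.cons ha (p.takeUntil x hxp)).induce _ ?_⟩
            intro y hy
            rw [Walk.support_cons, List.mem_cons] at hy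
            refine ⟨hy.imp id fun h => p.support_takeUntil_subset_support hxp h, ?_⟩
            rintro rfl
            exact hy.elim hvw hvt
  obtain ⟨B, hAB, hB⟩ := (Set.toFinite {A : Set V | 2 ≤ A.ncard ∧ (G.induce A).Connected ∧
      ∀ v ∈ A, (G.induce (A \ {v})).Connected}).exists_le_maximal key
  exact ⟨B, hB, hAB haA, hAB hbA⟩

lemma aux_adj [Fintype V] (G : SimpleGraph V) (hBG : IsBlockGraph G) {w a b : V}
    (hc : (G.induce {x | x ≠ w}).Connected) (hab : a ≠ b) (ha : G.Adj w a) (hb : G.Adj w b) :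
    G.Adj a b := by
  classical
  obtain ⟨q, hq⟩ := (hc.preconnected ⟨a, ha.ne'⟩ ⟨b, hb.ne'⟩).exists_isPath
  let f : G.induce {x | x ≠ w} ↪g G := Embedding.induce _
  have hp : (q.map f.toHom).IsPath := Walk.map_isPath_of_injective f.injective hq
  have hw : w ∉ (q.map f.toHom).support := by
    rw [Walk.support_map, List.mem_map]
    rintro ⟨⟨y, hy⟩, -, h⟩
    exact hy h
  obtain ⟨B, hB, h1, h2⟩ := aux_block G (q.map f.toHom) hp hab hw ha hb
  exact hBG.2 B hB a h1 b h2 hab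

lemma aux_bound [Fintype V] (G : SimpleGraph V) {c : V → ℕ} {k : ℕ}
    (h : IsGrundyColoring G c k) : k ≤ Fintype.card V := by
  classical
  have : Finset.Icc 1 k ⊆ Finset.univ.image c := by
    intro i hi
    obtain ⟨v, hv⟩ := h.2.2.1 i hi
    exact Finset.mem_image.2 ⟨v, Finset.mem_univ _, hv⟩
  have h2 := (Finset.card_le_card this).trans Finset.card_image_le
  simpa using h2

/-- In a connected block graph there is a vertex `w` with `Γ_G(w) = Γ(G)`;
moreover if `Γ(G) > ω(G)` then every such vertex is a cut-vertex. -/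
theorem statement_2 [Fintype V] [Nonempty V] (G : SimpleGraph V) (hBG : IsBlockGraph G) :
    (∃ w, grundyAt G w = grundyNumber G) ∧
      (G.cliqueNum < grundyNumber G →
        ∀ w, grundyAt G w = grundyNumber G → IsCutVertex G w) := by
  classical
  have hbd1 : BddAbove {k | ∃ c, IsGrundyColoring G c k} :=
    ⟨Fintype.card V, fun k ⟨c, h⟩ => aux_bound G h⟩
  have hbd2 : ∀ u, BddAbove {j | ∃ c k, IsGrundyColoring G c k ∧ c u = j} := by
    rintro u
    refine ⟨Fintype.card V, ?_⟩
    rintro j ⟨c, k, h, rfl⟩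
    exact (Finset.mem_Icc.1 (h.1 u)).2.trans (aux_bound G h)
  constructor
  · by_cases hne : {k | ∃ c, IsGrundyColoring G c k}.Nonempty
    · obtain ⟨c, hc⟩ := Nat.sSup_mem hne hbd1
      change IsGrundyColoring G c (grundyNumber G) at hc
      obtain ⟨v0⟩ := ‹Nonempty V›
      have h0 := Finset.mem_Icc.1 (hc.1 v0)
      obtain ⟨w, hw⟩ := hc.2.2.1 (grundyNumber G) (Finset.mem_Icc.2 ⟨h0.1.trans h0.2, le_rfl⟩)
      refine ⟨w, le_antisymm ?_ ?_⟩
      · refine csSup_le ⟨_, c, _, hc, rfl⟩ ?_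
        rintro j ⟨c', k, h, rfl⟩
        exact (Finset.mem_Icc.1 (h.1 w)).2.trans (le_csSup hbd1 ⟨c', h⟩)
      · exact le_csSup (hbd2 w) ⟨c, _, hc, hw⟩
    · obtain ⟨w⟩ := ‹Nonempty V›
      refine ⟨w, ?_⟩
      have e1 : {k | ∃ c, IsGrundyColoring G c k} = ∅ := Set.not_nonempty_iff_eq_empty.1 hne
      have e2 : {j | ∃ c k, IsGrundyColoring G c k ∧ c w = j} = ∅ := by
        rw [Set.eq_empty_iff_forall_notMem]
        rintro j ⟨c, k, h, -⟩
        exact hne ⟨k, c, h⟩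
      rw [grundyAt, grundyNumber, e1, e2]
  · intro hlt w hw hcon
    have hne : {j | ∃ c k, IsGrundyColoring G c k ∧ c w = j}.Nonempty := by
      by_contra hne
      have : grundyAt G w = 0 := by
        rw [grundyAt, Set.not_nonempty_iff_eq_empty.1 hne]; simp
      omega
    obtain ⟨c, k, hc, hcw⟩ := Nat.sSup_mem hne (hbd2 w)
    change c w = grundyAt G w at hcw
    have hcl : G.IsClique ((insert w (G.neighborFinset w) : Finset V) : Set V) := by
      rw [Finset.coe_insert, isClique_insert]
      refine ⟨?_, ?_⟩
      · intro a ha b hb hab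
        exact aux_adj G hBG hcon hab (by simpa using ha) (by simpa using hb)
      · intro b hb _
        simpa using hb
    have h1 := hcl.card_le_cliqueNum
    have h2 : Finset.Icc 1 (c w) ⊆ (insert w (G.neighborFinset w)).image c := by
      intro i hi
      rw [Finset.mem_Icc] at hi
      rcases hi.2.eq_or_lt with h | h
      · exact Finset.mem_image.2 ⟨w, by simp, h.symm⟩
      · obtain ⟨x, hx, hxi⟩ := hc.2.2.2 w i (Finset.mem_Ico.2 ⟨hi.1, h⟩)
        exact Finset.mem_image.2 ⟨x, by simp [hx], hxi⟩
    have h3 := (Finset.card_le_card h2).trans Finset.card_image_le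
    rw [Nat.card_Icc] at h3
    omega
end

section
/- Let G be a connected block graph and let w be a vertex of G that is not a cut-vertex, and let B be the unique block of G containing w. Then Γ_G(w) = |V(B)|. -/
open SimpleGraph

variable {V : Type*}

/-- A set with a hub vertex reached by walks inside the set induces a connected graph. -/
lemma induce_connected_of_hub (G : SimpleGraph V) (S : Set V) (h : V) (hh : h ∈ S)
    (H : ∀ x ∈ S, ∃ q : G.Walk x h, ∀ y ∈ q.support, y ∈ S) : (G.induce S).Connected := by
  rw [connected_iff_exists_forall_reachable]
  refine ⟨⟨h, hh⟩, ?_⟩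
  rintro ⟨x, hx⟩
  obtain ⟨q, hq⟩ := H x hx
  exact (Walk.reachable (q.induce S hq)).symm

/-- All neighbors of a non-cut-vertex lie in any complete block containing it. -/
lemma nbr_mem_block [Fintype V] (G : SimpleGraph V) (hBG : IsBlockGraph G)
    (w : V) (hw : ¬ IsCutVertex G w) (B : Set V) (hB : IsBlock G B) (hwB : w ∈ B)
    (u : V) (hu : G.Adj w u) : u ∈ B := by
  classical
  have hcl := hBG.2 B hB
  obtain ⟨b, hbB, hbw⟩ : ∃ b ∈ B, b ≠ w :=
    Set.exists_ne_of_one_lt_ncard (by have := hB.1.1; omega) w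
  unfold IsCutVertex at hw
  push Not at hw
  obtain ⟨p0, hp0⟩ := hw.exists_isPath ⟨u, hu.ne'⟩ ⟨b, hbw⟩
  obtain ⟨p, hp, hpw⟩ : ∃ p : G.Walk u b, p.IsPath ∧ w ∉ p.support := by
    refine ⟨p0.map (Embedding.induce _).toHom,
      Walk.IsPath.map (Embedding.induce (G := G) _).injective hp0, ?_⟩
    intro hmem
    have hmem := (Walk.support_map _ p0) ▸ hmem
    rw [List.mem_map] at hmem
    obtain ⟨⟨x, hx⟩, _, h⟩ := hmem
    exact hx h
  set A : Set V := B ∪ {x | x ∈ p.support} with hA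
  have hBA : B ⊆ A := Set.subset_union_left
  -- every vertex other than `v` reaches `w` avoiding `v`, for `v` other than `w`
  have key : ∀ v, v ≠ w → (G.induce (A \ {v})).Connected := by
    intro v hv
    refine induce_connected_of_hub G _ w ⟨hBA hwB, fun h => hv h.symm⟩ ?_
    have direct : ∀ x ∈ B, x ≠ v → ∃ q : G.Walk x w, ∀ y ∈ q.support, y ∈ A \ {v} := by
      intro x hx hxv
      by_cases hxw : x = w
      · subst hxw
        refine ⟨Walk.nil, ?_⟩
        intro y hy
        simp only [Walk.support_nil, List.mem_singleton] at hy
        subst hy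
        exact ⟨hBA hx, hxv⟩
      · refine ⟨(hcl x hx w hwB hxw).toWalk, ?_⟩
        intro y hy
        simp at hy
        rcases hy with rfl | rfl
        · exact ⟨hBA hx, hxv⟩
        · exact ⟨hBA hwB, fun h => hv h.symm⟩
    rintro x ⟨hx, hxv⟩
    have hxv : x ≠ v := hxv
    rcases hx with hx | hx
    · exact direct x hx hxv
    · have hx : x ∈ p.support := hx
      by_cases h1 : v ∈ (p.takeUntil x hx).support
      · have h2 : v ∉ (p.dropUntil x hx).support := by
          intro h2
          have hn := hp.support_nodup
          rw [← p.take_spec hx, Walk.support_append, List.nodup_append] at hn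
          rw [Walk.mem_support_iff] at h2
          rcases h2 with h2 | h2
          · exact hxv h2.symm
          · exact hn.2.2 v h1 v h2 rfl
        have hbv : b ≠ v := by
          rintro rfl
          exact h2 (Walk.end_mem_support _)
        obtain ⟨q, hq⟩ := direct b hbB hbv
        refine ⟨(p.dropUntil x hx).append q, ?_⟩
        intro y hy
        rw [Walk.mem_support_append_iff] at hy
        rcases hy with hy | hy
        · refine ⟨Or.inr (p.support_dropUntil_subset_support hx hy), ?_⟩
          rintro rfl
          exact h2 hy
        · exact hq y hy
      · refine ⟨(p.takeUntil x hx).reverse.append hu.symm.toWalk, ?_⟩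
        intro y hy
        have hyy : y ∈ (p.takeUntil x hx).support ∨ y = w := by
          rw [Walk.mem_support_append_iff] at hy
          rcases hy with hy | hy
          · left; simpa using hy
          · simp at hy
            rcases hy with rfl | rfl
            · left; exact Walk.start_mem_support _
            · right; rfl
        rcases hyy with hy | rfl
        · refine ⟨Or.inr (p.support_takeUntil_subset_support hx hy), ?_⟩
          rintro rfl
          exact h1 hy
        · exact ⟨hBA hwB, fun h => hv h.symm⟩
  have keyw : (G.induce (A \ {w})).Connected := by
    refine induce_connected_of_hub G _ b ⟨hBA hbB, hbw⟩ ?_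
    rintro x ⟨hx, hxw⟩
    rcases hx with hx | hx
    · by_cases hxb : x = b
      · subst hxb
        refine ⟨Walk.nil, ?_⟩
        intro y hy
        simp only [Walk.support_nil, List.mem_singleton] at hy
        subst hy
        exact ⟨hBA hx, hxw⟩
      · refine ⟨(hcl x hx b hbB hxb).toWalk, ?_⟩
        intro y hy
        simp at hy
        rcases hy with rfl | rfl
        · exact ⟨hBA hx, hxw⟩
        · exact ⟨hBA hbB, hbw⟩
    · have hx : x ∈ p.support := hx
      refine ⟨p.dropUntil x hx, ?_⟩
      intro y hy
      have hy' := p.support_dropUntil_subset_support hx hy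
      refine ⟨Or.inr hy', ?_⟩
      rintro rfl
      exact hpw hy'
  have keyA : (G.induce A).Connected := by
    refine induce_connected_of_hub G _ w (hBA hwB) ?_
    intro x hx
    by_cases hxw : x = w
    · subst hxw
      refine ⟨Walk.nil, ?_⟩
      intro y hy
      simp only [Walk.support_nil, List.mem_singleton] at hy
      subst hy
      exact hx
    · obtain ⟨q0⟩ := keyw.preconnected ⟨x, hx, hxw⟩ ⟨b, hBA hbB, hbw⟩
      obtain ⟨q1, hq1⟩ : ∃ q1 : G.Walk x b, ∀ y ∈ q1.support, y ∈ A := by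
        refine ⟨q0.map (Embedding.induce _).toHom, ?_⟩
        intro y hy
        have hy := (Walk.support_map _ q0) ▸ hy
        rw [List.mem_map] at hy
        obtain ⟨⟨z, hz⟩, _, rfl⟩ := hy
        exact hz.1
      refine ⟨q1.append (hcl b hbB w hwB hbw).toWalk, ?_⟩
      intro y hy
      rw [Walk.mem_support_append_iff] at hy
      rcases hy with hy | hy
      · exact hq1 y hy
      · simp at hy
        rcases hy with rfl | rfl
        · exact hBA hbB
        · exact hBA hwB
  have hAB : A ⊆ B := by
    refine hB.2 ⟨hB.1.1.trans (Set.ncard_le_ncard hBA (Set.toFinite _)), keyA, ?_⟩ hBA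
    intro v _
    by_cases hv : v = w
    · subst hv; exact keyw
    · exact key v hv
  exact hAB (Or.inr p.start_mem_support)

/-- A Grundy coloring of the subgraph induced by a finite set of vertices. -/
def PartGrundy (G : SimpleGraph V) (S : Finset V) (c : V → ℕ) : Prop :=
  (∀ v ∈ S, 1 ≤ c v) ∧ (∀ x ∈ S, ∀ y ∈ S, G.Adj x y → c x ≠ c y) ∧
  (∀ v ∈ S, ∀ i, 1 ≤ i → i < c v → ∃ z ∈ S, G.Adj v z ∧ c z = i)

/-- Greedy extension of a partial Grundy coloring by one vertex. -/
lemma PartGrundy.extend [DecidableEq V] (G : SimpleGraph V) (S : Finset V) (c : V → ℕ)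
    (h : PartGrundy G S c) (a : V) (ha : a ∉ S) :
    ∃ c', PartGrundy G (insert a S) c' ∧ ∀ v ∈ S, c' v = c v := by
  classical
  obtain ⟨h1, h2, h3⟩ := h
  have hex : ∃ n, 1 ≤ n ∧ ∀ z ∈ S, G.Adj a z → c z ≠ n := by
    refine ⟨S.sup c + 1, by omega, ?_⟩
    intro z hz _
    have := Finset.le_sup (f := c) hz
    omega
  set n := Nat.find hex with hn
  have hn1 := Nat.find_spec hex
  have hmin : ∀ i, 1 ≤ i → i < n → ∃ z ∈ S, G.Adj a z ∧ c z = i := by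
    intro i hi hin
    have := Nat.find_min hex hin
    push Not at this
    exact this hi
  have hsame : ∀ v ∈ S, Function.update c a n v = c v := by
    intro v hv
    have hva : v ≠ a := by
      rintro rfl
      exact ha hv
    exact Function.update_of_ne hva _ _
  have ha' : Function.update c a n a = n := Function.update_self _ _ _
  refine ⟨Function.update c a n, ⟨?_, ?_, ?_⟩, hsame⟩
  · intro v hv
    rcases Finset.mem_insert.1 hv with rfl | hv
    · rw [ha']; exact hn1.1
    · rw [hsame v hv]; exact h1 v hv
  · intro x hx y hy hxy
    rcases Finset.mem_insert.1 hx with rfl | hx' <;>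
      rcases Finset.mem_insert.1 hy with rfl | hy'
    · exact absurd hxy (G.loopless.irrefl _)
    · rw [ha', hsame y hy']; exact (hn1.2 y hy' hxy).symm
    · rw [ha', hsame x hx']; exact hn1.2 x hx' hxy.symm
    · rw [hsame x hx', hsame y hy']; exact h2 x hx' y hy' hxy
  · intro v hv i hi hiv
    rcases Finset.mem_insert.1 hv with rfl | hv
    · rw [ha'] at hiv
      obtain ⟨z, hz, hvz, hc⟩ := hmin i hi hiv
      exact ⟨z, Finset.mem_insert_of_mem hz, hvz, by rw [hsame z hz, hc]⟩
    · rw [hsame v hv] at hiv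
      obtain ⟨z, hz, hvz, hc⟩ := h3 v hv i hi hiv
      exact ⟨z, Finset.mem_insert_of_mem hz, hvz, by rw [hsame z hz, hc]⟩

/-- A partial Grundy coloring extends to any larger finite set. -/
lemma PartGrundy.extend_union [DecidableEq V] (G : SimpleGraph V) (S : Finset V) (c : V → ℕ)
    (h : PartGrundy G S c) (T : Finset V) :
    ∃ c', PartGrundy G (T ∪ S) c' ∧ ∀ v ∈ S, c' v = c v := by
  induction T using Finset.induction_on with
  | empty => exact ⟨c, by simpa using h, fun _ _ => rfl⟩
  | insert a T _ ih =>
    obtain ⟨c', hc', hs⟩ := ih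
    rw [Finset.insert_union]
    by_cases ha : a ∈ T ∪ S
    · rw [Finset.insert_eq_of_mem ha]; exact ⟨c', hc', hs⟩
    · obtain ⟨c'', h'', hs''⟩ := PartGrundy.extend G _ c' hc' a ha
      exact ⟨c'', h'', fun v hv => by rw [hs'' v (Finset.mem_union_right _ hv), hs v hv]⟩

lemma exists_partGrundy_clique [DecidableEq V] (G : SimpleGraph V) (T : Finset V) (w : V)
    (hw : w ∉ T)
    (hcl : ∀ u ∈ insert w T, ∀ v ∈ insert w T, u ≠ v → G.Adj u v) :
    ∃ c, PartGrundy G (insert w T) c ∧ c w = T.card + 1 := by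
  classical
  let e := T.equivFin
  let c : V → ℕ := fun v => if h : v ∈ T then (e ⟨v, h⟩ : ℕ) + 1 else T.card + 1
  have hcw : c w = T.card + 1 := by simp [c, hw]
  have hcT : ∀ v (h : v ∈ T), c v = (e ⟨v, h⟩ : ℕ) + 1 := fun v h => by simp [c, h]
  have hlt : ∀ v ∈ T, c v < T.card + 1 := by
    intro v h
    rw [hcT v h]
    have := (e ⟨v, h⟩).2
    omega
  have hle : ∀ v ∈ insert w T, c v ≤ T.card + 1 := by
    intro v hv
    rcases Finset.mem_insert.1 hv with rfl | hv
    · exact hcw.le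
    · exact (hlt v hv).le
  refine ⟨c, ⟨?_, ?_, ?_⟩, hcw⟩
  · intro v _
    by_cases h : v ∈ T <;> simp [c, h]
  · intro x hx y hy hxy
    rcases Finset.mem_insert.1 hx with rfl | hx' <;>
      rcases Finset.mem_insert.1 hy with rfl | hy'
    · exact absurd hxy (G.loopless.irrefl _)
    · rw [hcw]; exact (hlt y hy').ne'
    · rw [hcw]; exact (hlt x hx').ne
    · rw [hcT x hx', hcT y hy']
      intro h
      have h1 : e ⟨x, hx'⟩ = e ⟨y, hy'⟩ := Fin.ext (by omega)
      have h2 := e.injective h1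
      exact hxy.ne (congrArg Subtype.val h2)
  · intro v hv i hi hiv
    have := hle v hv
    let z := e.symm ⟨i - 1, by omega⟩
    have hz : c z.1 = i := by
      rw [hcT z.1 z.2]
      have : e ⟨z.1, z.2⟩ = ⟨i - 1, by omega⟩ := e.apply_symm_apply _
      rw [this]
      simp only
      omega
    have hzm : z.1 ∈ insert w T := Finset.mem_insert_of_mem z.2
    refine ⟨z.1, hzm, hcl v hv z.1 hzm ?_, hz⟩
    intro h
    rw [h, hz] at hiv
    omega

/-- If `w` is a non-cut-vertex of a connected block graph `G` and `B` is the
(unique) block of `G` containing `w`, then `Γ_G(w) = |V(B)|`. -/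
theorem statement_3 [Fintype V] (G : SimpleGraph V) (hBG : IsBlockGraph G)
    (w : V) (hw : ¬ IsCutVertex G w) (B : Set V) (hB : IsBlock G B) (hwB : w ∈ B) :
    grundyAt G w = B.ncard := by
  classical
  let T : Finset V := B.toFinset.erase w
  have hwT : w ∉ T := by simp [T]
  have hins : insert w T = B.toFinset := Finset.insert_erase (by simpa using hwB)
  have hcard : B.ncard = T.card + 1 := by
    rw [Set.ncard_eq_toFinset_card', ← hins, Finset.card_insert_of_notMem hwT]
  rw [hcard]
  refine IsGreatest.csSup_eq ⟨?_, ?_⟩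
  · obtain ⟨c0, hc0, hw0⟩ := exists_partGrundy_clique G T w hwT (by
      rw [hins]
      intro u hu v hv huv
      exact hBG.2 B hB u (by simpa using hu) v (by simpa using hv) huv)
    obtain ⟨c, ⟨h1, h2, h3⟩, hs⟩ := PartGrundy.extend_union G _ c0 hc0 Finset.univ
    have hall : ∀ v, v ∈ Finset.univ ∪ insert w T := fun v => by simp
    obtain ⟨m, _, hm⟩ := Finset.exists_max_image Finset.univ c ⟨w, Finset.mem_univ _⟩
    refine ⟨c, c m, ⟨?_, ?_, ?_, ?_⟩, ?_⟩
    · intro v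
      exact Finset.mem_Icc.2 ⟨h1 v (hall v), hm v (Finset.mem_univ _)⟩
    · intro x y hxy
      exact h2 x (hall x) y (hall y) hxy
    · intro i hi
      rw [Finset.mem_Icc] at hi
      rcases hi.2.eq_or_lt with h | h
      · exact ⟨m, h.symm⟩
      · obtain ⟨z, _, _, hz⟩ := h3 m (hall m) i hi.1 h
        exact ⟨z, hz⟩
    · intro v i hi
      rw [Finset.mem_Ico] at hi
      obtain ⟨z, _, hz⟩ := h3 v (hall v) i hi.1 hi.2
      exact ⟨z, hz⟩
    · rw [hs w (Finset.mem_insert_self _ _), hw0]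
  · rintro j ⟨c, k, ⟨_, _, _, hg⟩, rfl⟩
    have hsub : Finset.Ico 1 (c w) ⊆ T.image c := by
      intro i hi
      obtain ⟨z, hz, rfl⟩ := hg w i hi
      refine Finset.mem_image_of_mem c ?_
      have := nbr_mem_block G hBG w hw B hB hwB z hz
      simp [T, this, hz.ne']
    have := (Finset.card_le_card hsub).trans Finset.card_image_le
    rw [Nat.card_Ico] at this
    omega
end

section
/- Let G be a connected block graph with at least one cut-vertex, let ω = ω(G) be its clique number, and let Δ̃ = Δ̃(G) be the maximum, over all cut-vertices v of G, of the number of blocks of G that contain v. Then Γ(G) ≤ Δ̃·(ω − 1) + 1. -/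
open SimpleGraph

variable {V : Type*}

/-- The non-maximal part of the definition of a block. -/
def PreBlock (G : SimpleGraph V) (A : Set V) : Prop :=
  2 ≤ A.ncard ∧ (G.induce A).Connected ∧ ∀ v ∈ A, (G.induce (A \ {v})).Connected

lemma conn_of_walks (G : SimpleGraph V) {s : Set V} (u : V) (hu : u ∈ s)
    (h : ∀ v ∈ s, ∃ p : G.Walk u v, ∀ x ∈ p.support, x ∈ s) : (G.induce s).Connected := by
  refine induce_connected_of_patches u hu ?_
  intro v hv
  obtain ⟨p, hp⟩ := h v hv
  exact ⟨{x | x ∈ p.support}, hp, p.start_mem_support, p.end_mem_support,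
    p.connected_induce_support.preconnected _ _⟩

lemma exists_block [Finite V] (G : SimpleGraph V) {A : Set V} (hA : PreBlock G A) :
    ∃ B, IsBlock G B ∧ A ⊆ B := by
  obtain ⟨B, hB, hm⟩ := Finite.exists_le_maximal hA
  exact ⟨B, hm, hB⟩

lemma edge_preBlock (G : SimpleGraph V) {a b : V} (h : G.Adj a b) : PreBlock G {a, b} := by
  have hne := h.ne
  refine ⟨by rw [Set.ncard_pair hne], induce_pair_connected_of_adj h, ?_⟩
  have key : ∀ z : V, (G.induce ({z} : Set V)).Connected := fun z =>
    conn_of_walks G z rfl (by rintro v rfl; exact ⟨Walk.nil, by simp⟩)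
  intro v hv
  rcases hv with rfl | hv
  · have : ({v, b} : Set V) \ {v} = {b} := by ext x; simp; grind
    rw [this]; exact key b
  · rw [Set.mem_singleton_iff] at hv
    subst hv
    have : ({a, v} : Set V) \ {v} = {a} := by ext x; simp; grind
    rw [this]; exact key a

lemma cycle_preBlock [Finite V] (G : SimpleGraph V) {v a b : V} (ha : G.Adj v a) (hb : G.Adj v b)
    (p : G.Walk a b) (hp : p.IsPath) (hv : v ∉ p.support) :
    PreBlock G (insert v {x | x ∈ p.support}) := by
  classical
  have hva : v ≠ a := ha.ne
  refine ⟨?_, ?_, ?_⟩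
  · calc 2 = ({v, a} : Set V).ncard := (Set.ncard_pair hva).symm
      _ ≤ _ := Set.ncard_le_ncard (by
        rintro x (rfl | rfl)
        · exact Set.mem_insert _ _
        · exact Set.mem_insert_of_mem _ p.start_mem_support) (Set.toFinite _)
  · refine conn_of_walks G v (Set.mem_insert _ _) ?_
    rintro y (rfl | hy)
    · exact ⟨Walk.nil, by simp⟩
    · refine ⟨Walk.cons ha (p.takeUntil y hy), ?_⟩
      intro x hx
      rw [Walk.support_cons, List.mem_cons] at hx
      rcases hx with rfl | hx
      · exact Set.mem_insert _ _
      · exact Set.mem_insert_of_mem _ (p.support_takeUntil_subset_support hy hx)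
  · intro x hx
    by_cases hxv : x = v
    · subst hxv
      have : (insert x {y | y ∈ p.support} : Set V) \ {x} = {y | y ∈ p.support} := by
        ext y; simp only [Set.mem_diff, Set.mem_insert_iff, Set.mem_setOf_eq,
          Set.mem_singleton_iff]
        grind
      rw [this]
      exact p.connected_induce_support
    · refine conn_of_walks G v ⟨Set.mem_insert _ _, fun h => hxv h.symm⟩ ?_
      rintro y ⟨rfl | hy, hyx⟩
      · exact ⟨Walk.nil, by simpa using fun h => hxv h.symm⟩
      · have hy' : y ∈ p.support := hy
        have hyx' : y ≠ x := hyx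
        by_cases hx1 : x ∈ (p.takeUntil y hy').support
        · have hx2 : x ∉ (p.dropUntil y hy').support := by
            intro hx2
            have hp' := hp
            rw [← p.take_spec hy'] at hp'
            exact hp'.ne_of_mem_support_of_append hyx'.symm hx1 hx2 rfl
          refine ⟨Walk.cons hb (p.dropUntil y hy').reverse, ?_⟩
          intro z hz
          rw [Walk.support_cons, List.mem_cons, Walk.support_reverse, List.mem_reverse] at hz
          rcases hz with rfl | hz
          · exact ⟨Set.mem_insert _ _, fun h => hxv h.symm⟩
          · refine ⟨Set.mem_insert_of_mem _ (p.support_dropUntil_subset_support hy' hz), ?_⟩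
            rintro rfl
            exact hx2 hz
        · refine ⟨Walk.cons ha (p.takeUntil y hy'), ?_⟩
          intro z hz
          rw [Walk.support_cons, List.mem_cons] at hz
          rcases hz with rfl | hz
          · exact ⟨Set.mem_insert _ _, fun h => hxv h.symm⟩
          · refine ⟨Set.mem_insert_of_mem _ (p.support_takeUntil_subset_support hy' hz), ?_⟩
            rintro rfl
            exact hx1 hz

lemma nbr_adj [Finite V] (G : SimpleGraph V) (hBG : IsBlockGraph G) {v a b : V}
    (hv : ¬ IsCutVertex G v) (ha : G.Adj v a) (hb : G.Adj v b) (hab : a ≠ b) : G.Adj a b := by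
  classical
  have hc : (G.induce {w | w ≠ v}).Connected := not_not.mp hv
  obtain ⟨q⟩ := hc.preconnected ⟨a, ha.ne'⟩ ⟨b, hb.ne'⟩
  let q' : G.Walk a b := q.map (Embedding.induce {w | w ≠ v}).toHom
  have hq' : v ∉ q'.support := by
    intro h
    have h2 : v ∈ (q.map (Embedding.induce {w | w ≠ v}).toHom).support := h
    rw [Walk.support_map, List.mem_map] at h2
    obtain ⟨y, _, hy⟩ := h2
    exact y.2 hy
  have hpb : v ∉ q'.bypass.support := fun h => hq' (q'.support_bypass_subset h)
  obtain ⟨B, hB, hsub⟩ := exists_block G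
    (cycle_preBlock G ha hb q'.bypass q'.bypass_isPath hpb)
  exact hBG.2 B hB a (hsub (Set.mem_insert_of_mem _ q'.bypass.start_mem_support)) b
    (hsub (Set.mem_insert_of_mem _ q'.bypass.end_mem_support)) hab

lemma ncard_le_cliqueNum [Fintype V] (G : SimpleGraph V) {B : Set V} (hB : G.IsClique B) :
    B.ncard ≤ G.cliqueNum := by
  classical
  rw [Set.ncard_eq_toFinset_card']
  have hB2 : G.IsClique (B.toFinset : Set V) := by simpa using hB
  exact IsClique.card_le_cliqueNum (tc := hB2)

lemma nbr_le_blocks [Fintype V] (G : SimpleGraph V) (hBG : IsBlockGraph G) (v : V) :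
    (G.neighborSet v).ncard ≤ blockDegree G v * (G.cliqueNum - 1) := by
  classical
  let S : Finset (Set V) := {B : Set V | IsBlock G B ∧ v ∈ B}.toFinset
  have hS : blockDegree G v = S.card := Set.ncard_eq_toFinset_card' _
  have hsub : (G.neighborSet v).toFinset ⊆ S.biUnion (fun B => (B \ {v}).toFinset) := by
    intro w hw
    have hw' : G.Adj v w := by simpa using hw
    obtain ⟨B, hB, hs⟩ := exists_block G (edge_preBlock G hw')
    rw [Finset.mem_biUnion]
    refine ⟨B, ?_, ?_⟩
    · simp only [S, Set.mem_toFinset]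
      exact ⟨hB, hs (by simp)⟩
    · rw [Set.mem_toFinset]
      exact ⟨hs (by simp), hw'.ne'⟩
  rw [Set.ncard_eq_toFinset_card', hS]
  refine (Finset.card_le_card hsub).trans (Finset.card_biUnion_le_card_mul _ _ _ ?_)
  intro B hB
  simp only [S, Set.mem_toFinset] at hB
  obtain ⟨hB, hvB⟩ := hB
  rw [← Set.ncard_eq_toFinset_card', Set.ncard_diff_singleton_of_mem hvB]
  exact Nat.sub_le_sub_right
    (ncard_le_cliqueNum G (fun a ha b hb hab => hBG.2 B hB a ha b hb hab)) 1

lemma nbr_le_of_not_cut [Fintype V] (G : SimpleGraph V) (hBG : IsBlockGraph G) (v : V)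
    (hv : ¬ IsCutVertex G v) : (G.neighborSet v).ncard ≤ G.cliqueNum - 1 := by
  have h : G.IsClique (insert v (G.neighborSet v)) := by
    rintro a (rfl | ha) b (rfl | hb) hab
    · exact absurd rfl hab
    · exact hb
    · exact ha.symm
    · exact nbr_adj G hBG hv ha hb hab
  have := ncard_le_cliqueNum G h
  rw [Set.ncard_insert_of_notMem (by simp)] at this
  omega

lemma blockDegree_le [Fintype V] (G : SimpleGraph V) {v : V} (hv : IsCutVertex G v) :
    blockDegree G v ≤ maxCutBlockDegree G := by
  refine le_csSup (Set.Finite.bddAbove ?_) ⟨v, hv, rfl⟩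
  refine (Set.finite_range (blockDegree G)).subset ?_
  rintro n ⟨w, _, rfl⟩
  exact ⟨w, rfl⟩

lemma one_le_blockDegree [Fintype V] (G : SimpleGraph V) {v w : V} (h : G.Adj v w) :
    1 ≤ blockDegree G v := by
  obtain ⟨B, hB, hs⟩ := exists_block G (edge_preBlock G h)
  exact (Set.ncard_pos (Set.toFinite _)).mpr ⟨B, hB, hs (by simp)⟩

lemma color_le [Fintype V] (G : SimpleGraph V) {c : V → ℕ} {k : ℕ} (h : IsGrundyColoring G c k)
    (v : V) : c v ≤ (G.neighborSet v).ncard + 1 := by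
  have hsub : ((Finset.Ico 1 (c v) : Finset ℕ) : Set ℕ) ⊆ c '' (G.neighborSet v) := by
    intro i hi
    obtain ⟨w, hw, rfl⟩ := h.2.2.2 v i (by simpa using hi)
    exact ⟨w, hw, rfl⟩
  have h1 := Set.ncard_le_ncard hsub (Set.toFinite _)
  have h2 := Set.ncard_image_le (f := c) (Set.toFinite (G.neighborSet v))
  rw [Set.ncard_coe_finset, Nat.card_Ico] at h1
  omega

/-- For a connected block graph with at least one cut-vertex,
`Γ(G) ≤ Δ̃(G)·(ω(G) − 1) + 1`. -/
theorem statement_5 [Fintype V] (G : SimpleGraph V) (hBG : IsBlockGraph G)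
    (hcut : ∃ v, IsCutVertex G v) :
    grundyNumber G ≤ maxCutBlockDegree G * (G.cliqueNum - 1) + 1 := by
  apply csSup_le'
  rintro k ⟨c, hc⟩
  rcases Nat.eq_zero_or_pos k with rfl | hk
  · exact Nat.zero_le _
  obtain ⟨v, hv⟩ := hc.2.2.1 k (Finset.mem_Icc.mpr ⟨hk, le_rfl⟩)
  have hcol := color_le G hc v
  rw [hv] at hcol
  refine hcol.trans (Nat.add_le_add_right ?_ 1)
  by_cases hcv : IsCutVertex G v
  · exact (nbr_le_blocks G hBG v).trans (Nat.mul_le_mul_right _ (blockDegree_le G hcv))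
  · rcases Set.eq_empty_or_nonempty (G.neighborSet v) with he | ⟨w, hw⟩
    · rw [he]; simp
    · obtain ⟨x, hx⟩ := hcut
      have : Nontrivial V := ⟨v, w, G.ne_of_adj hw⟩
      obtain ⟨y, hy⟩ := hBG.1.preconnected.exists_adj_of_nontrivial x
      have h1 : 1 ≤ maxCutBlockDegree G := (one_le_blockDegree G hy).trans (blockDegree_le G hx)
      exact (nbr_le_of_not_cut G hBG v hcv).trans (Nat.le_mul_of_pos_left _ h1)
end

section
/- For every pair of integers t ≥ 2 and p ≥ 2, there exists a connected block graph G with Δ̃(G) = t, ω(G) = p, and Γ(G) = t·(p − 1) + 1 = Δ̃(G)·(ω(G) − 1) + 1. -/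
open SimpleGraph

variable {V : Type*}

namespace S6

/-- The extremal graph: `f` and `g` are adjacent iff they differ in exactly one coordinate `i`
and vanish below `i`. -/
def gr (t q : ℕ) : SimpleGraph (Fin t → Fin (q + 1)) where
  Adj f g := ∃ i, f i ≠ g i ∧ (∀ j, i < j → f j = g j) ∧ (∀ j, j < i → f j = 0 ∧ g j = 0)
  symm := ⟨by
    rintro f g ⟨i, h1, h2, h3⟩
    exact ⟨i, h1.symm, fun j hj => (h2 j hj).symm, fun j hj => (h3 j hj).symm⟩⟩
  loopless := ⟨by
    rintro f ⟨i, h1, _⟩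
    exact h1 rfl⟩

def clq {t q : ℕ} (i : Fin t) (f : Fin t → Fin (q + 1)) : Set (Fin t → Fin (q + 1)) :=
  {g | (∀ j, i < j → g j = f j) ∧ ∀ j, j < i → g j = 0}

variable {t q : ℕ}

def mk (i : Fin t) (f : Fin t → Fin (q + 1)) (a : Fin (q + 1)) : Fin t → Fin (q + 1) :=
  fun j => if j < i then 0 else if j = i then a else f j

lemma mk_self (i : Fin t) (f : Fin t → Fin (q + 1)) (a : Fin (q + 1)) : mk i f a i = a := by
  simp [mk]

lemma mk_mem (i : Fin t) (f : Fin t → Fin (q + 1)) (a : Fin (q + 1)) : mk i f a ∈ clq i f := by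
  refine ⟨fun j hj => ?_, fun j hj => ?_⟩
  · simp [mk, not_lt_of_gt hj, hj.ne']
  · simp [mk, hj]

lemma mk_inj (i : Fin t) (f : Fin t → Fin (q + 1)) : Function.Injective (mk i f) := by
  intro a b h
  have := congrFun h i
  simpa [mk_self] using this

lemma clq_eq_range (i : Fin t) (f : Fin t → Fin (q + 1)) : clq i f = Set.range (mk i f) := by
  ext g
  constructor
  · rintro ⟨h1, h2⟩
    refine ⟨g i, ?_⟩
    funext j
    rcases lt_trichotomy j i with h | h | h
    · simp [mk, h, h2 j h]
    · subst h; simp [mk]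
    · simp [mk, not_lt_of_gt h, h.ne', h1 j h]
  · rintro ⟨a, rfl⟩
    exact mk_mem i f a

lemma clq_ncard (i : Fin t) (f : Fin t → Fin (q + 1)) : (clq i f).ncard = q + 1 := by
  rw [clq_eq_range, ← Set.image_univ, Set.ncard_image_of_injective _ (mk_inj i f)]
  simp [Set.ncard_univ]

lemma clq_adj (i : Fin t) (f : Fin t → Fin (q + 1)) {x y} (hx : x ∈ clq i f) (hy : y ∈ clq i f)
    (hxy : x ≠ y) : (gr t q).Adj x y := by
  refine ⟨i, fun h => hxy ?_, fun j hj => (hx.1 j hj).trans (hy.1 j hj).symm,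
    fun j hj => ⟨hx.2 j hj, hy.2 j hj⟩⟩
  funext j
  rcases lt_trichotomy j i with h' | h' | h'
  · rw [hx.2 j h', hy.2 j h']
  · subst h'; exact h
  · rw [hx.1 j h', hy.1 j h']

lemma clq_sub {i i' : Fin t} {f f' : Fin t → Fin (q + 1)} (hq : 1 ≤ q)
    (h : clq i f ⊆ clq i' f') : i = i' ∧ clq i f = clq i' f' := by
  have h0 := h (mk_mem i f 0)
  have h1 := h (mk_mem i f (Fin.last q))
  have hne : (0 : Fin (q+1)) ≠ Fin.last q := by
    intro h; have := congrArg Fin.val h; simp at this; omega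
  have hi : i = i' := by
    rcases lt_trichotomy i i' with h' | h' | h'
    · have := h1.2 i h'
      rw [mk_self] at this
      exact absurd this.symm hne
    · exact h'
    · have a := h0.1 i h'
      have b := h1.1 i h'
      rw [mk_self] at a b
      exact absurd (a.trans b.symm) hne
  subst hi
  refine ⟨rfl, ?_⟩
  have : ∀ j, i < j → f j = f' j := fun j hj => ((mk_mem i f 0).1 j hj).symm.trans (h0.1 j hj)
  ext g
  constructor
  · exact fun hg => h hg
  · exact fun hg => ⟨fun j hj => (hg.1 j hj).trans (this j hj).symm, hg.2⟩

lemma closed_of_conn {V : Type*} {G : SimpleGraph V} {S : Set V} (hS : (G.induce S).Connected)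
    (P : V → Prop) (hP : ∀ x ∈ S, ∀ y ∈ S, G.Adj x y → P x → P y) {a b : V} (ha : a ∈ S)
    (hb : b ∈ S) (hPa : P a) : P b := by
  obtain ⟨w⟩ := hS.preconnected ⟨a, ha⟩ ⟨b, hb⟩
  have key : ∀ (x y : S), (G.induce S).Walk x y → P x → P y := by
    intro x y w
    induction w with
    | nil => exact id
    | cons h _ ih => exact fun hx => ih (hP _ (Subtype.prop _) _ (Subtype.prop _) h hx)
  exact key _ _ w hPa

def Good {V : Type*} (G : SimpleGraph V) (A : Set V) : Prop :=
  2 ≤ A.ncard ∧ (G.induce A).Connected ∧ ∀ v ∈ A, (G.induce (A \ {v})).Connected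

lemma conn_of_clique {V : Type*} {G : SimpleGraph V} {S : Set V} (hn : S.Nonempty)
    (h : ∀ x ∈ S, ∀ y ∈ S, x ≠ y → G.Adj x y) : (G.induce S).Connected := by
  have : Nonempty S := hn.to_subtype
  refine ⟨fun x y => ?_⟩
  by_cases hxy : x = y
  · subst hxy; exact Reachable.refl _
  · exact Adj.reachable (h x x.2 y y.2 (fun h => hxy (Subtype.ext h)))

lemma good_of_clique {V : Type*} {G : SimpleGraph V} {S : Set V} (hn : 2 ≤ S.ncard)
    (h : ∀ x ∈ S, ∀ y ∈ S, x ≠ y → G.Adj x y) : Good G S := by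
  refine ⟨hn, conn_of_clique ?_ h, fun v hv => conn_of_clique ?_
    fun x hx y hy => h x hx.1 y hy.1⟩
  · exact Set.nonempty_of_ncard_ne_zero (by omega)
  · obtain ⟨b, hb, hbv⟩ := Set.exists_ne_of_one_lt_ncard (by omega : 1 < S.ncard) v
    exact ⟨b, hb, hbv⟩

lemma good_sub {A : Set (Fin t → Fin (q + 1))} (hA : Good (gr t q) A) :
    ∃ i f, A ⊆ clq i f := by
  classical
  obtain ⟨hc, hconn, hcut⟩ := hA
  obtain ⟨x, hx, y, hy, hxy⟩ := (Set.one_lt_ncard (Set.toFinite A)).1 (by omega : 1 < A.ncard)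
  let D : Finset (Fin t) := Finset.univ.filter fun i => ∃ a ∈ A, ∃ b ∈ A, a i ≠ b i
  have hD : D.Nonempty := by
    obtain ⟨i, hi⟩ := Function.ne_iff.1 hxy
    exact ⟨i, by simp only [D, Finset.mem_filter, Finset.mem_univ, true_and]; exact ⟨x, hx, y, hy, hi⟩⟩
  have hmem := D.max'_mem hD
  set i := D.max' hD with hi
  have habove : ∀ j, i < j → ∀ a ∈ A, ∀ b ∈ A, a j = b j := by
    intro j hj a ha b hb
    by_contra hne
    have : j ∈ D := by
      simp only [D, Finset.mem_filter, Finset.mem_univ, true_and]; exact ⟨a, ha, b, hb, hne⟩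
    exact absurd (D.le_max' j this) (not_le_of_gt hj)
  simp only [D, Finset.mem_filter, Finset.mem_univ, true_and] at hmem
  obtain ⟨c, hc, d, hd, hcd⟩ := hmem
  refine ⟨i, x, fun a ha => ⟨fun j hj => habove j hj a ha x hx, fun j hj => ?_⟩⟩
  by_contra hne
  let u : Fin t → Fin (q + 1) := mk i a (a i)
  have hua : ∀ k, i ≤ k → u k = a k := by
    intro k hk
    rcases hk.eq_or_lt with rfl | hk
    · exact mk_self _ _ _
    · exact (mk_mem i a (a i)).1 k hk
  have hub : ∀ k, k < i → u k = 0 := (mk_mem i a (a i)).2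
  have hau : a ≠ u := by
    intro h
    have := congrFun h j
    rw [hub j hj] at this
    exact hne this
  have hcon : ((gr t q).induce (A \ {u})).Connected := by
    by_cases hu : u ∈ A
    · exact hcut u hu
    · rwa [Set.sdiff_singleton_eq_self hu]
  have hcl : ∀ z ∈ A, z i = a i := by
    intro z hz
    by_cases hzu : z = u
    · rw [hzu]; exact hua i le_rfl
    · refine closed_of_conn hcon (fun z => ∀ k, i ≤ k → z k = a k) ?_
        (a := a) (b := z) ⟨ha, hau⟩ ⟨hz, hzu⟩ (fun _ _ => rfl) i le_rfl
      rintro z ⟨hz, hzu⟩ w ⟨hw, hwu⟩ ⟨m, h1, h2, h3⟩ hza k hk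
      rcases lt_or_ge m i with hm | hm
      · rw [← h2 k (hm.trans_le hk)]; exact hza k hk
      · exfalso
        apply hzu
        show z = u
        funext k
        rcases lt_or_ge k i with hki | hki
        · rw [hub k hki]; exact (h3 k (hki.trans_le hm)).1
        · rw [hua k hki]; exact hza k hki
  exact hcd ((hcl c hc).trans (hcl d hd).symm)

lemma clq_good (hq : 1 ≤ q) (i : Fin t) (f : Fin t → Fin (q + 1)) : Good (gr t q) (clq i f) :=
  good_of_clique (by rw [clq_ncard]; omega) fun _ hx _ hy h => clq_adj i f hx hy h

lemma block_iff (hq : 1 ≤ q) (B : Set (Fin t → Fin (q + 1))) :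
    IsBlock (gr t q) B ↔ ∃ i f, B = clq i f := by
  constructor
  · intro h
    obtain ⟨i, f, hB⟩ := good_sub h.1
    exact ⟨i, f, hB.antisymm (h.2 (clq_good hq i f) hB)⟩
  · rintro ⟨i, f, rfl⟩
    refine ⟨clq_good hq i f, fun A hA hle => ?_⟩
    obtain ⟨i', f', hB⟩ := good_sub hA
    have := (clq_sub hq (hle.trans hB)).2
    rw [this]
    exact hB

lemma conn (t q : ℕ) : (gr t q).Connected := by
  have : Nonempty (Fin t → Fin (q + 1)) := ⟨0⟩
  have key : ∀ (f : Fin t → Fin (q + 1)) (m : ℕ), m ≤ t →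
      (gr t q).Reachable f (fun j => if j.val < m then 0 else f j) := by
    intro f m
    induction m with
    | zero => intro _; simp
    | succ m ih =>
      intro hm
      refine (ih (by omega)).trans ?_
      by_cases h : f ⟨m, hm⟩ = 0
      · convert Reachable.refl _ using 1
        funext j
        by_cases hj : j.val = m
        · have : j = ⟨m, hm⟩ := Fin.ext hj
          subst this; simp [h]
        · have : j.val < m + 1 ↔ j.val < m := by omega
          simp [this]
      · apply Adj.reachable
        refine ⟨⟨m, hm⟩, by simpa using h, fun j hj => ?_, fun j hj => ?_⟩
        · have : m < j.val := hj
          simp [show ¬ j.val < m by omega, show ¬ j.val < m + 1 by omega]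
        · have : j.val < m := hj
          simp [this, show j.val < m + 1 by omega]
  have h0 : ∀ f, (gr t q).Reachable f 0 := by
    intro f
    have := key f t le_rfl
    convert this using 1
    funext j
    simp [j.2]
  exact ⟨fun f g => (h0 f).trans (h0 g).symm⟩

lemma isBlockGraph (hq : 1 ≤ q) : IsBlockGraph (gr t q) := by
  refine ⟨conn t q, fun B hB u hu v hv huv => ?_⟩
  obtain ⟨i, f, rfl⟩ := (block_iff hq B).1 hB
  exact clq_adj i f hu hv huv

lemma blocks_eq (hq : 1 ≤ q) (f : Fin t → Fin (q + 1)) :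
    {B | IsBlock (gr t q) B ∧ f ∈ B} = (fun i => clq i f) '' {i | ∀ j, j < i → f j = 0} := by
  ext B
  constructor
  · rintro ⟨hB, hf⟩
    obtain ⟨i, g, rfl⟩ := (block_iff hq B).1 hB
    refine ⟨i, hf.2, ?_⟩
    ext h
    exact ⟨fun hh => ⟨fun j hj => (hh.1 j hj).trans (hf.1 j hj), hh.2⟩,
      fun hh => ⟨fun j hj => (hh.1 j hj).trans (hf.1 j hj).symm, hh.2⟩⟩
  · rintro ⟨i, hi, rfl⟩
    exact ⟨(block_iff hq _).2 ⟨i, f, rfl⟩, fun _ _ => rfl, hi⟩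

lemma maxCut (ht : 2 ≤ t) (hq : 1 ≤ q) : maxCutBlockDegree (gr t q) = t := by
  apply IsGreatest.csSup_eq
  constructor
  · refine ⟨0, ?_, ?_⟩
    · intro hcon
      let a : Fin t := ⟨0, by omega⟩
      let b : Fin t := ⟨t - 1, by omega⟩
      have hab : a ≠ b := by
        intro h; have := congrArg Fin.val h; simp [a, b] at this; omega
      have hl : Fin.last q ≠ 0 := by
        intro h; have := congrArg Fin.val h; simp at this; omega
      have hne : ∀ k : Fin t, (Pi.single k (Fin.last q) : Fin t → Fin (q + 1)) ≠ 0 := by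
        intro k h
        have := congrFun h k
        simp at this
        omega
      have := closed_of_conn hcon (fun f => f b ≠ 0) ?_ (a := Pi.single b (Fin.last q))
        (b := Pi.single a (Fin.last q)) (hne b) (hne a) (by rw [Pi.single_eq_same]; exact hl)
      · exact this (by rw [Pi.single_eq_of_ne hab.symm])
      · rintro x hx y hy ⟨i, h1, h2, h3⟩ hxb hyb
        have hib : ¬ i < b := fun h => hxb ((h2 b h).trans hyb)
        have hib' : i = b := by
          apply Fin.ext
          have h1 : ¬ i.val < t - 1 := hib
          have := i.2
          show i.val = t - 1
          omega
        subst hib'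
        apply hy
        funext j
        by_cases hj : j = b
        · rw [hj]; exact hyb
        · refine (h3 j ?_).2
          have : j.val ≠ t - 1 := fun h => hj (Fin.ext h)
          show j.val < t - 1
          have := j.2
          omega
    · unfold blockDegree
      rw [blocks_eq hq]
      have : {i : Fin t | ∀ j, j < i → (0 : Fin t → Fin (q + 1)) j = 0} = Set.univ := by
        ext i; simp
      rw [this, Set.ncard_image_of_injective]
      · simp [Set.ncard_univ]
      · intro i j hij
        exact (clq_sub hq (le_of_eq hij)).1
  · rintro n ⟨f, _, rfl⟩
    unfold blockDegree
    rw [blocks_eq hq]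
    refine (Set.ncard_image_le (Set.toFinite _)).trans ?_
    refine (Set.ncard_le_ncard (Set.subset_univ _)).trans ?_
    simp [Set.ncard_univ]

lemma cliqueNum_eq (ht : 2 ≤ t) (hq : 1 ≤ q) : (gr t q).cliqueNum = q + 1 := by
  classical
  apply IsGreatest.csSup_eq
  constructor
  · refine ⟨(clq (⟨0, by omega⟩ : Fin t) 0).toFinset, ?_, ?_⟩
    · intro x hx y hy hxy
      simp only [Set.coe_toFinset] at hx hy
      exact clq_adj _ _ hx hy hxy
    · rw [← Set.ncard_eq_toFinset_card', clq_ncard]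
  · rintro n ⟨s, hs, rfl⟩
    by_cases h2 : 2 ≤ s.card
    · have hg : Good (gr t q) (s : Set _) :=
        good_of_clique (by rwa [Set.ncard_coe_finset]) fun x hx y hy hxy => hs hx hy hxy
      obtain ⟨i, f, h⟩ := good_sub hg
      have := Set.ncard_le_ncard h
      rwa [Set.ncard_coe_finset, clq_ncard] at this
    · omega

lemma grundy_le {c : (Fin t → Fin (q + 1)) → ℕ} {k : ℕ} (h : IsGrundyColoring (gr t q) c k) :
    k ≤ t * q + 1 := by
  classical
  obtain ⟨-, -, h3, h4⟩ := h
  rcases Nat.eq_zero_or_pos k with rfl | hk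
  · omega
  obtain ⟨f, hf⟩ := h3 k (Finset.mem_Icc.2 ⟨hk, le_rfl⟩)
  let S : Finset (Σ _ : Fin t, Fin (q + 1)) := Finset.univ.sigma fun i => Finset.univ.erase (f i)
  have hS : S.card = t * q := by
    simp [S, Finset.card_sigma]
  have hsub : Finset.Ico 1 k ⊆ S.image fun x => c (Function.update f x.1 x.2) := by
    intro i hi
    obtain ⟨w, ⟨m, h1, h2, h3⟩, hw⟩ := h4 f i (by rwa [hf])
    refine Finset.mem_image.2 ⟨⟨m, w m⟩, ?_, ?_⟩
    · simp [S, h1.symm]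
    · have : Function.update f m (w m) = w := by
        funext j
        rcases lt_trichotomy j m with h | h | h
        · rw [Function.update_of_ne h.ne, (h3 j h).1, (h3 j h).2]
        · subst h; simp
        · rw [Function.update_of_ne h.ne', h2 j h]
      simp only [this, hw]
  have := (Finset.card_le_card hsub).trans Finset.card_image_le
  rw [hS, Nat.card_Ico] at this
  omega

open Classical in
/-- The optimal coloring. -/
noncomputable def col (t q : ℕ) (f : Fin t → Fin (q + 1)) : ℕ :=
  if h : ∃ i, f i ≠ 0 ∧ ∀ j, j < i → f j = 0 then h.choose.val * q + (f h.choose).val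
  else t * q + 1

lemma col_of {f : Fin t → Fin (q + 1)} {i : Fin t} (h1 : f i ≠ 0) (h2 : ∀ j, j < i → f j = 0) :
    col t q f = i.val * q + (f i).val := by
  have h : ∃ i, f i ≠ 0 ∧ ∀ j, j < i → f j = 0 := ⟨i, h1, h2⟩
  have : h.choose = i := by
    obtain ⟨a, b⟩ := h.choose_spec
    rcases lt_trichotomy h.choose i with h' | h' | h'
    · exact absurd (h2 _ h') a
    · exact h'
    · exact absurd (b _ h') h1
  unfold col
  rw [dif_pos h, this]

lemma exists_min {f : Fin t → Fin (q + 1)} (hf : f ≠ 0) :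
    ∃ i, f i ≠ 0 ∧ ∀ j, j < i → f j = 0 := by
  classical
  let D : Finset (Fin t) := Finset.univ.filter fun i => f i ≠ 0
  have hD : D.Nonempty := by
    obtain ⟨i, hi⟩ := Function.ne_iff.1 hf
    exact ⟨i, by simpa [D] using hi⟩
  refine ⟨D.min' hD, by simpa [D] using D.min'_mem hD, fun j hj => ?_⟩
  by_contra h
  exact absurd (D.min'_le j (by simpa [D] using h)) (not_le_of_gt hj)

lemma col_zero : col t q 0 = t * q + 1 := by
  unfold col
  rw [dif_neg]
  rintro ⟨i, h, _⟩
  exact h rfl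

lemma decomp (hq : 1 ≤ q) {n : ℕ} (h1 : 1 ≤ n) : ∃ i a, n = i * q + a ∧ 1 ≤ a ∧ a ≤ q := by
  refine ⟨(n - 1) / q, (n - 1) % q + 1, ?_, by omega, Nat.mod_lt _ hq⟩
  have := Nat.div_add_mod' (n - 1) q
  omega

lemma lt_of_col {i j q a b : ℕ} (h : i * q + a < j * q + b) (ha : 1 ≤ a) (hb : b ≤ q) : i ≤ j := by
  by_contra hlt
  have : (j + 1) * q ≤ i * q := Nat.mul_le_mul_right q (by omega)
  rw [Nat.add_mul] at this
  omega

lemma lt_of_col' {i j q a b : ℕ} (h : i < j) (ha : a ≤ q) (hb : 1 ≤ b) :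
    i * q + a < j * q + b := by
  have : (i + 1) * q ≤ j * q := Nat.mul_le_mul_right q h
  rw [Nat.add_mul] at this
  omega

lemma col_gt {f : Fin t → Fin (q + 1)} {i : Fin t} (h : ∀ j, j ≤ i → f j = 0) {a : ℕ}
    (ha : a ≤ q) : i.val * q + a < col t q f := by
  by_cases hf : f = 0
  · subst hf
    rw [col_zero]
    exact lt_of_col' i.2 ha le_rfl
  · obtain ⟨k, h1, h2⟩ := exists_min hf
    rw [col_of h1 h2]
    have hik : i < k := by
      by_contra hh
      exact h1 (h k (not_lt.1 hh))
    exact lt_of_col' hik ha (Nat.one_le_iff_ne_zero.2 fun h => h1 (Fin.ext h))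

lemma pos_val {a : Fin (q + 1)} (h : a ≠ 0) : 1 ≤ a.val :=
  Nat.one_le_iff_ne_zero.2 fun h' => h (Fin.ext h')

lemma grundy_col (hq : 1 ≤ q) : IsGrundyColoring (gr t q) (col t q) (t * q + 1) := by
  refine ⟨fun f => ?_, ?_, ?_, ?_⟩
  · by_cases hf : f = 0
    · subst hf; rw [col_zero]; simp
    · obtain ⟨k, h1, h2⟩ := exists_min hf
      rw [col_of h1 h2, Finset.mem_Icc]
      have := lt_of_col' (q := q) (a := (f k).val) (b := 1) k.2 (by omega) le_rfl
      have := pos_val h1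
      omega
  · rintro f g ⟨i, h1, h2, h3⟩ heq
    by_cases hf : f i = 0
    · have hg : g i ≠ 0 := fun h => h1 (hf.trans h.symm)
      have e := col_of hg fun j hj => (h3 j hj).2
      have : i.val * q + (g i).val < col t q f := col_gt (fun j hj => by
        rcases hj.eq_or_lt with rfl | hj
        · exact hf
        · exact (h3 j hj).1) (by omega)
      omega
    · have e := col_of hf fun j hj => (h3 j hj).1
      by_cases hg : g i = 0
      · have : i.val * q + (f i).val < col t q g := col_gt (fun j hj => by
          rcases hj.eq_or_lt with rfl | hj
          · exact hg
          · exact (h3 j hj).2) (by omega)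
        omega
      · have e' := col_of hg fun j hj => (h3 j hj).2
        exact h1 (Fin.ext (by omega))
  · intro n hn
    rw [Finset.mem_Icc] at hn
    by_cases hn' : n = t * q + 1
    · exact ⟨0, by rw [col_zero, hn']⟩
    · obtain ⟨i, a, rfl, ha, haq⟩ := decomp hq hn.1
      have hi : i < t := by
        by_contra h
        have := Nat.mul_le_mul_right q (not_lt.1 h)
        omega
      refine ⟨mk ⟨i, hi⟩ 0 ⟨a, by omega⟩, ?_⟩
      rw [col_of (i := ⟨i, hi⟩), mk_self]
      · rw [mk_self]
        intro h
        have := congrArg Fin.val h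
        simp at this
        omega
      · exact (mk_mem _ _ _).2
  · intro f n hn
    rw [Finset.mem_Ico] at hn
    obtain ⟨i, a, rfl, ha, haq⟩ := decomp hq hn.1
    have key : ∃ hi : i < t, (∀ j, j < (⟨i, hi⟩ : Fin t) → f j = 0) ∧ (f ⟨i, hi⟩).val ≠ a := by
      by_cases hf : f = 0
      · subst hf
        rw [col_zero] at hn
        have hi : i < t := by
          by_contra h
          have := Nat.mul_le_mul_right q (not_lt.1 h)
          omega
        exact ⟨hi, fun _ _ => rfl, by simp; omega⟩
      · obtain ⟨k, h1, h2⟩ := exists_min hf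
        rw [col_of h1 h2] at hn
        have hik := lt_of_col hn.2 ha (by omega)
        refine ⟨by omega, fun j hj => h2 j (lt_of_lt_of_le hj hik), ?_⟩
        rcases hik.eq_or_lt with rfl | hlt
        · simp only [Fin.eta]; omega
        · rw [h2 _ hlt]; simp; omega
    obtain ⟨hi, hz, hne⟩ := key
    refine ⟨mk ⟨i, hi⟩ f ⟨a, by omega⟩, clq_adj ⟨i, hi⟩ f ⟨fun _ _ => rfl, hz⟩ (mk_mem _ _ _) ?_, ?_⟩
    · intro h
      have := congrFun h ⟨i, hi⟩
      rw [mk_self] at this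
      exact hne (congrArg Fin.val this)
    · rw [col_of (i := ⟨i, hi⟩), mk_self]
      · rw [mk_self]
        intro h
        have := congrArg Fin.val h
        simp at this
        omega
      · exact (mk_mem _ _ _).2

end S6

/-- For all `t ≥ 2` and `p ≥ 2` there is a connected block graph `G` with
`Δ̃(G) = t`, `ω(G) = p` and `Γ(G) = t(p − 1) + 1`. -/
theorem statement_6 (t p : ℕ) (ht : 2 ≤ t) (hp : 2 ≤ p) :
    ∃ (V : Type) (_ : Fintype V) (G : SimpleGraph V),
      IsBlockGraph G ∧ maxCutBlockDegree G = t ∧ G.cliqueNum = p ∧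
        grundyNumber G = t * (p - 1) + 1 := by
  obtain ⟨q, rfl⟩ : ∃ q, p = q + 1 := ⟨p - 1, by omega⟩
  have hq : 1 ≤ q := by omega
  refine ⟨Fin t → Fin (q + 1), inferInstance, S6.gr t q, S6.isBlockGraph hq, S6.maxCut ht hq,
    S6.cliqueNum_eq ht hq, ?_⟩
  apply IsGreatest.csSup_eq
  refine ⟨⟨S6.col t q, by simpa using S6.grundy_col hq⟩, ?_⟩
  rintro k ⟨c, hc⟩
  simpa using S6.grundy_le hc
end

section
/- For any finite simple graph G, Γ(G) ≤ Γ(G↑B), where G↑B is the graph obtained from G by adding an edge between every two non-adjacent vertices that belong to a common block of G (so that G↑B is a block graph on each connected component). -/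
open SimpleGraph

variable {V : Type*}

/-- `G↑B`: join every two distinct vertices lying in a common block of `G`. -/
def blockClosure (G : SimpleGraph V) : SimpleGraph V :=
  SimpleGraph.fromRel (fun u v => ∃ B, IsBlock G B ∧ u ∈ B ∧ v ∈ B)

/-- `a` and `b` are joined by a walk inside `A`. -/
def WalkIn (G : SimpleGraph V) (A : Set V) (a b : V) : Prop :=
  ∃ w : G.Walk a b, ∀ t ∈ w.support, t ∈ A

lemma WalkIn.mono {G : SimpleGraph V} {A A' : Set V} {a b : V} (h : WalkIn G A a b)
    (hA : A ⊆ A') : WalkIn G A' a b := by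
  obtain ⟨w, hw⟩ := h
  exact ⟨w, fun t ht => hA (hw t ht)⟩

lemma WalkIn.symm {G : SimpleGraph V} {A : Set V} {a b : V} (h : WalkIn G A a b) :
    WalkIn G A b a := by
  obtain ⟨w, hw⟩ := h
  exact ⟨w.reverse, fun t ht => hw t (by simpa using ht)⟩

lemma WalkIn.trans {G : SimpleGraph V} {A : Set V} {a b c : V} (h : WalkIn G A a b)
    (h' : WalkIn G A b c) : WalkIn G A a c := by
  obtain ⟨w, hw⟩ := h
  obtain ⟨w', hw'⟩ := h'
  refine ⟨w.append w', fun t ht => ?_⟩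
  rcases Walk.mem_support_append_iff _ _ |>.1 ht with h | h
  · exact hw t h
  · exact hw' t h

lemma WalkIn.right_mem {G : SimpleGraph V} {A : Set V} {a b : V} (h : WalkIn G A a b) :
    b ∈ A := by
  obtain ⟨w, hw⟩ := h
  exact hw _ w.end_mem_support

lemma joinedIn_of_connected {G : SimpleGraph V} {A : Set V} (h : (G.induce A).Connected)
    {a b : V} (ha : a ∈ A) (hb : b ∈ A) : WalkIn G A a b := by
  obtain ⟨w⟩ := h.preconnected ⟨a, ha⟩ ⟨b, hb⟩
  refine ⟨w.map (Embedding.induce A).toHom, fun t ht => ?_⟩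
  have ht' := ht
  erw [Walk.support_map, List.mem_map] at ht'
  obtain ⟨s, -, rfl⟩ := ht'
  exact s.2

lemma connected_of_joinedIn {G : SimpleGraph V} {A : Set V} {b : V} (hb : b ∈ A)
    (h : ∀ a ∈ A, WalkIn G A a b) : (G.induce A).Connected := by
  rw [connected_iff_exists_forall_reachable]
  refine ⟨⟨b, hb⟩, fun ⟨a, ha⟩ => ?_⟩
  obtain ⟨w, hw⟩ := (h a ha).symm
  exact ⟨w.induce A hw⟩

/-- Every vertex of a path other than `v` is joined to an endpoint of the path avoiding `v`. -/
lemma path_joined {G : SimpleGraph V} {x z : V} (p : G.Walk x z) (hp : p.IsPath) (v a : V)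
    (ha : a ∈ p.support) (hav : a ≠ v) :
    WalkIn G ({t | t ∈ p.support} \ {v}) a x ∨ WalkIn G ({t | t ∈ p.support} \ {v}) a z := by
  classical
  by_cases hv : v ∈ (p.takeUntil a ha).support
  · right
    refine ⟨p.dropUntil a ha, fun t ht => ⟨p.support_dropUntil_subset ha ht, ?_⟩⟩
    rintro rfl
    have h1 := hp.support_nodup
    rw [← p.take_spec ha, Walk.support_append] at h1
    have h2 := List.disjoint_of_nodup_append h1
    rw [Walk.mem_support_iff] at ht
    rcases ht with h | h
    · exact hav h.symm
    · exact h2 hv h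
  · left
    refine WalkIn.symm ⟨p.takeUntil a ha, fun t ht => ⟨p.support_takeUntil_subset ha ht, ?_⟩⟩
    rintro rfl
    exact hv ht

/-- If blocks `B`, `B'` share `y` and are linked avoiding `y`, then `B' ⊆ B`. -/
lemma block_merge [Fintype V] {G : SimpleGraph V} {B B' : Set V} (hB : IsBlock G B)
    (hB' : IsBlock G B') {x y z : V} (hx : x ∈ B) (hy : y ∈ B) (hz : z ∈ B') (hy' : y ∈ B')
    (hzy : z ≠ y) (hxy : x ≠ y) (h : WalkIn G {y}ᶜ x z) : z ∈ B := by
  classical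
  obtain ⟨w, hw⟩ := h
  obtain ⟨⟨hBc, hBconn, hBr⟩, hmax⟩ := hB
  obtain ⟨⟨-, hBconn', hBr'⟩, -⟩ := hB'
  have removed : ∀ {C : Set V}, (G.induce C).Connected → (∀ v ∈ C, (G.induce (C \ {v})).Connected) →
      ∀ v a b, a ∈ C → b ∈ C → a ≠ v → b ≠ v → WalkIn G (C \ {v}) a b := by
    intro C h1 h2 v a b ha hb hav hbv
    by_cases hv : v ∈ C
    · exact joinedIn_of_connected (h2 v hv) ⟨ha, hav⟩ ⟨hb, hbv⟩
    · rw [Set.sdiff_singleton_eq_self hv]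
      exact joinedIn_of_connected h1 ha hb
  let p := w.bypass
  have hp : p.IsPath := w.bypass_isPath
  have hpy : ∀ t ∈ p.support, t ≠ y := fun t ht => hw t (w.support_bypass_subset ht)
  let P : Set V := {t | t ∈ p.support}
  let A : Set V := B ∪ B' ∪ P
  have sB : B ⊆ A := fun t ht => Or.inl (Or.inl ht)
  have sB' : B' ⊆ A := fun t ht => Or.inl (Or.inr ht)
  have sP : P ⊆ A := fun t ht => Or.inr ht
  have key : ∀ v, v ≠ y → ∀ a ∈ A, a ≠ v → WalkIn G (A \ {v}) a y := by
    intro v hv a ha hav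
    have kB : ∀ a ∈ B, a ≠ v → WalkIn G (A \ {v}) a y := fun a ha hav =>
      (removed hBconn hBr v a y ha hy hav hv.symm).mono (Set.sdiff_subset_sdiff_left sB)
    have kB' : ∀ a ∈ B', a ≠ v → WalkIn G (A \ {v}) a y := fun a ha hav =>
      (removed hBconn' hBr' v a y ha hy' hav hv.symm).mono (Set.sdiff_subset_sdiff_left sB')
    rcases ha with (ha | ha) | ha
    · exact kB a ha hav
    · exact kB' a ha hav
    · rcases path_joined p hp v a ha hav with h | h
      · exact (h.mono (Set.sdiff_subset_sdiff_left sP)).trans (kB x hx h.right_mem.2)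
      · exact (h.mono (Set.sdiff_subset_sdiff_left sP)).trans (kB' z hz h.right_mem.2)
  refine hmax (y := A) ⟨hBc.trans (Set.ncard_le_ncard sB (Set.toFinite _)), ?_, ?_⟩ sB (sB' hz)
  · refine connected_of_joinedIn (sB hy) fun a ha => ?_
    by_cases hax : a = x
    · exact (joinedIn_of_connected hBconn (hax ▸ hx) hy).mono sB
    · exact (key x hxy a ha hax).mono Set.sdiff_subset
  · intro v hv
    by_cases hvy : v = y
    · subst hvy
      have px : WalkIn G (A \ {v}) x z := ⟨p, fun t ht => ⟨sP ht, hpy t ht⟩⟩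
      refine connected_of_joinedIn (b := x) ⟨sB hx, hxy⟩ fun a ha => ?_
      obtain ⟨(ha | ha) | ha, hav⟩ := ha
      · exact (removed hBconn hBr v a x ha hx hav hxy).mono (Set.sdiff_subset_sdiff_left sB)
      · exact ((removed hBconn' hBr' v a z ha hz hav hzy).mono
          (Set.sdiff_subset_sdiff_left sB')).trans px.symm
      · rcases path_joined p hp v a ha hav with h | h
        · exact h.mono (Set.sdiff_subset_sdiff_left sP)
        · exact (h.mono (Set.sdiff_subset_sdiff_left sP)).trans px.symm
    · exact connected_of_joinedIn (b := y) ⟨sB hy, fun h => hvy h.symm⟩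
        fun a ha => key v hvy a ha.1 ha.2

lemma blockClosure_adj {G : SimpleGraph V} {a b : V} :
    (blockClosure G).Adj a b ↔ a ≠ b ∧ ∃ B, IsBlock G B ∧ a ∈ B ∧ b ∈ B := by
  unfold blockClosure
  rw [fromRel_adj]
  constructor
  · rintro ⟨h, ⟨B, h1, h2, h3⟩ | ⟨B, h1, h2, h3⟩⟩
    · exact ⟨h, B, h1, h2, h3⟩
    · exact ⟨h, B, h1, h3, h2⟩
  · rintro ⟨h, h'⟩
    exact ⟨h, Or.inl h'⟩

lemma le_blockClosure [Fintype V] (G : SimpleGraph V) : G ≤ blockClosure G := by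
  intro a b hab
  have hne : a ≠ b := hab.ne
  rw [blockClosure_adj]
  refine ⟨hne, ?_⟩
  have hcand : (fun A : Set V => 2 ≤ A.ncard ∧ (G.induce A).Connected ∧
    ∀ v ∈ A, (G.induce (A \ {v})).Connected) {a, b} := by
    refine ⟨(Set.ncard_pair hne).ge, ?_, ?_⟩
    · refine connected_of_joinedIn (b := b) (by simp) fun t ht => ?_
      rcases ht with rfl | rfl
      · exact ⟨Walk.cons hab Walk.nil, by simp⟩
      · exact ⟨Walk.nil, by simp⟩
    · intro v hv
      rcases hv with rfl | rfl
      · refine connected_of_joinedIn (b := b) ⟨by simp, hne.symm⟩ fun t ht => ?_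
        obtain ⟨rfl | rfl, h⟩ := ht
        · exact absurd rfl h
        · exact ⟨Walk.nil, by simpa using hne.symm⟩
      · refine connected_of_joinedIn (b := a) ⟨by simp, hne⟩ fun t ht => ?_
        obtain ⟨rfl | rfl, h⟩ := ht
        · exact ⟨Walk.nil, by simpa using hne⟩
        · exact absurd rfl h
  obtain ⟨B, hle, hB⟩ := (Set.toFinite {A : Set V | 2 ≤ A.ncard ∧ (G.induce A).Connected ∧
    ∀ v ∈ A, (G.induce (A \ {v})).Connected}).exists_le_maximal hcand
  exact ⟨B, hB, hle (by simp), hle (by simp)⟩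

/-- Partial Grundy colorings extend greedily. -/
lemma grundy_extend [Fintype V] (H : SimpleGraph V) (W : Set V) (c : V → ℕ)
    (h1 : ∀ v ∈ W, 1 ≤ c v) (h2 : ∀ x ∈ W, ∀ y ∈ W, H.Adj x y → c x ≠ c y)
    (h3 : ∀ v ∈ W, ∀ i ∈ Finset.Ico 1 (c v), ∃ w ∈ W, H.Adj v w ∧ c w = i) :
    ∃ c' : V → ℕ, (∀ v ∈ W, c' v = c v) ∧ (∀ v, 1 ≤ c' v) ∧ (∀ x y, H.Adj x y → c' x ≠ c' y) ∧
      (∀ v, ∀ i ∈ Finset.Ico 1 (c' v), ∃ w, H.Adj v w ∧ c' w = i) := by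
  classical
  induction hn : Wᶜ.ncard generalizing W c with
  | zero =>
    have hW : W = Set.univ := by
      rw [Set.ncard_eq_zero (Set.toFinite _)] at hn
      simpa using hn
    subst hW
    refine ⟨c, fun _ _ => rfl, fun v => h1 v trivial, fun x y => h2 x trivial y trivial, ?_⟩
    intro v i hi
    obtain ⟨w, -, h⟩ := h3 v trivial i hi
    exact ⟨w, h⟩
  | succ n ih =>
    obtain ⟨v, hv⟩ : Wᶜ.Nonempty := by
      apply Set.nonempty_of_ncard_ne_zero
      omega
    have hv' : v ∉ W := hv
    have hex : ∃ j, 1 ≤ j ∧ ∀ w ∈ W, H.Adj v w → c w ≠ j := by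
      refine ⟨Finset.univ.sup c + 1, by omega, fun w _ _ h => ?_⟩
      have := Finset.le_sup (f := c) (Finset.mem_univ w)
      omega
    obtain ⟨hj1, hj2⟩ := Nat.find_spec hex
    have hmin : ∀ i, i < Nat.find hex → ¬ _ := fun i hi => Nat.find_min hex hi
    generalize Nat.find hex = j at hj1 hj2 hmin
    have hne : ∀ w ∈ W, w ≠ v := fun w hw h => hv' (h ▸ hw)
    have hc : ∀ w ∈ W, Function.update c v j w = c w := fun w hw =>
      Function.update_of_ne (hne w hw) _ _
    have hcv : Function.update c v j v = j := Function.update_self _ _ _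
    have main := ih (insert v W) (Function.update c v j) ?_ ?_ ?_ ?_
    · obtain ⟨c', g1, g2⟩ := main
      exact ⟨c', fun w hw => (g1 w (Or.inr hw)).trans (hc w hw), g2⟩
    · rintro w (rfl | hw)
      · rwa [hcv]
      · rw [hc w hw]; exact h1 w hw
    · rintro a (rfl | ha) b (rfl | hb) hab
      · exact absurd hab (H.irrefl)
      · rw [hcv, hc b hb]; exact (hj2 b hb hab).symm
      · rw [hcv, hc a ha]; exact hj2 a ha hab.symm
      · rw [hc a ha, hc b hb]; exact h2 a ha b hb hab
    · rintro a (rfl | ha) i hi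
      · rw [hcv, Finset.mem_Ico] at hi
        have := hmin i hi.2
        push Not at this
        obtain ⟨w, hw, hadj, he⟩ := this hi.1
        exact ⟨w, Or.inr hw, hadj, by rw [hc w hw, he]⟩
      · rw [hc a ha] at hi
        obtain ⟨w, hw, hadj, he⟩ := h3 a ha i hi
        exact ⟨w, Or.inr hw, hadj, by rw [hc w hw, he]⟩
    · have : (insert v W)ᶜ = Wᶜ \ {v} := by
        ext t; simp [and_comm]
      rw [this, Set.ncard_diff_singleton_of_mem hv, hn]; rfl

/-- One reduction step: remove the branch at `y`. -/
lemma reduce_step [Fintype V] {G : SimpleGraph V} {c : V → ℕ} {u x y : V} {W : Set V}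
    (hmin : Minimal (fun W : Set V => u ∈ W ∧ (∀ w ∈ W, G.Reachable u w) ∧
      ∀ v ∈ W, ∀ i ∈ Finset.Ico 1 (c v), ∃ w ∈ W, (blockClosure G).Adj v w ∧ c w = i) W)
    (hx : x ∈ W) (hy : y ∈ W) (hadj : (blockClosure G).Adj x y) (hc : c x = c y)
    (hu : WalkIn G {y}ᶜ x u) : False := by
  obtain ⟨⟨huW, hreach, hgr⟩, hmin⟩ := hmin
  obtain ⟨hxy, B, hB, hxB, hyB⟩ := blockClosure_adj.1 hadj
  have hxx : WalkIn G {y}ᶜ x x := ⟨Walk.nil, by simpa using hxy⟩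
  have := hmin (y := {w | w ∈ W ∧ WalkIn G {y}ᶜ x w}) ⟨⟨huW, hu⟩, fun w hw => hreach w hw.1, ?_⟩
    (fun w hw => hw.1) hy
  · exact this.2.right_mem rfl
  · rintro z ⟨hzW, hz⟩ i hi
    obtain ⟨w, hwW, hzw, rfl⟩ := hgr z hzW i hi
    by_cases hw : WalkIn G {y}ᶜ x w
    · exact ⟨w, ⟨hwW, hw⟩, hzw, rfl⟩
    obtain ⟨hne, B', hB', hzB', hwB'⟩ := blockClosure_adj.1 hzw
    have hzy : z ≠ y := hz.right_mem
    have hwy : w = y := by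
      by_contra hwy
      apply hw
      refine hz.trans ?_
      by_cases hyB' : y ∈ B'
      · exact (joinedIn_of_connected (hB'.1.2.2 y hyB') ⟨hzB', hzy⟩ ⟨hwB', hwy⟩).mono
          fun t ht => ht.2
      · exact (joinedIn_of_connected hB'.1.2.1 hzB' hwB').mono
          fun t ht h => hyB' (h ▸ ht)
    subst hwy
    have hzB : z ∈ B := block_merge hB hB' hxB hyB hzB' hwB' hzy hxy hz
    refine ⟨x, ⟨hx, hxx⟩, blockClosure_adj.2 ⟨?_, B, hB, hzB, hxB⟩, hc⟩
    rintro rfl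
    rw [Finset.mem_Ico] at hi
    omega

/-- `Γ(G) ≤ Γ(G↑B)`. -/
theorem statement_8 [Fintype V] (G : SimpleGraph V) :
    grundyNumber G ≤ grundyNumber (blockClosure G) := by
  classical
  have hbdd : BddAbove {k | ∃ c, IsGrundyColoring (blockClosure G) c k} := by
    refine ⟨Fintype.card V, ?_⟩
    rintro k ⟨c, -, -, h, -⟩
    have : Finset.Icc 1 k ⊆ Finset.univ.image c := fun i hi => by
      obtain ⟨v, hv⟩ := h i hi
      exact Finset.mem_image.2 ⟨v, Finset.mem_univ _, hv⟩
    have := (Finset.card_le_card this).trans Finset.card_image_le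
    simpa using this
  unfold grundyNumber
  apply csSup_le'
  rintro k ⟨c, hc1, hc2, hc3, hc4⟩
  rcases Nat.eq_zero_or_pos k with rfl | hk
  · exact Nat.zero_le _
  obtain ⟨u, hu⟩ := hc3 k (Finset.mem_Icc.2 ⟨hk, le_rfl⟩)
  have hstart : (fun W : Set V => u ∈ W ∧ (∀ w ∈ W, G.Reachable u w) ∧
      ∀ v ∈ W, ∀ i ∈ Finset.Ico 1 (c v), ∃ w ∈ W, (blockClosure G).Adj v w ∧ c w = i)
      {w | G.Reachable u w} := by
    refine ⟨Reachable.refl u, fun w hw => hw, fun v hv i hi => ?_⟩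
    obtain ⟨w, hvw, hw⟩ := hc4 v i hi
    exact ⟨w, Reachable.trans hv hvw.reachable, le_blockClosure G hvw, hw⟩
  obtain ⟨W, -, hW⟩ := (Set.toFinite {W : Set V | u ∈ W ∧ (∀ w ∈ W, G.Reachable u w) ∧
      ∀ v ∈ W, ∀ i ∈ Finset.Ico 1 (c v), ∃ w ∈ W,
        (blockClosure G).Adj v w ∧ c w = i}).exists_le_minimal hstart
  have hproper : ∀ x ∈ W, ∀ y ∈ W, (blockClosure G).Adj x y → c x ≠ c y := by
    intro x hx y hy hxy heq
    obtain ⟨w⟩ := hW.1.2.1 x hx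
    have hp := w.bypass_isPath
    generalize w.bypass = p at hp
    by_cases hyp : y ∈ p.support
    · refine reduce_step hW hy hx hxy.symm heq.symm (WalkIn.symm ⟨p.takeUntil y hyp, ?_⟩)
      rintro t ht rfl
      exact Walk.endpoint_notMem_support_takeUntil hp hyp hxy.ne ht
    · refine reduce_step hW hx hy hxy heq (WalkIn.symm ⟨p, ?_⟩)
      rintro t ht rfl
      exact hyp ht
  obtain ⟨c', g1, g2, g3, g4⟩ := grundy_extend (blockClosure G) W c
    (fun v _ => (Finset.mem_Icc.1 (hc1 v)).1) hproper hW.1.2.2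
  have hle : ∀ v, c' v ≤ Finset.univ.sup c' := fun v => Finset.le_sup (Finset.mem_univ v)
  have hk' : k ≤ Finset.univ.sup c' := by
    rw [← hu, ← g1 u hW.1.1]; exact hle u
  refine hk'.trans (le_csSup hbdd ⟨c', fun v => Finset.mem_Icc.2 ⟨g2 v, hle v⟩, g3, ?_, g4⟩)
  intro i hi
  obtain ⟨m, -, hm⟩ := Finset.exists_mem_eq_sup Finset.univ ⟨u, Finset.mem_univ u⟩ c'
  rw [hm, Finset.mem_Icc] at hi
  rcases hi.2.eq_or_lt with h | h
  · exact ⟨m, h.symm⟩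
  · obtain ⟨w, -, hw⟩ := g4 m i (Finset.mem_Ico.2 ⟨hi.1, h⟩)
    exact ⟨w, hw⟩
end

section
/- Let G be a connected graph with at least one cut-vertex, let β be the maximum number of vertices of a block of G, and let Δ̃ be the maximum, over all cut-vertices v of G, of the number of blocks of G containing v. Then Γ(G) ≤ (β − 1)·Δ̃ + 1. -/
open SimpleGraph

variable {V : Type*}

lemma union_conn {G : SimpleGraph V} {s t : Set V}
    (hs : (G.induce s).Connected) (ht : (G.induce t).Connected) (h : (s ∩ t).Nonempty) :
    (G.induce (s ∪ t)).Connected :=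
  induce_union_connected hs.preconnected ht.preconnected h

lemma edge_block [Finite V] (G : SimpleGraph V) {u w : V} (h : G.Adj u w) :
    ∃ B, IsBlock G B ∧ u ∈ B ∧ w ∈ B := by
  have hs : ∀ x : V, (G.induce ({x} : Set V)).Connected := by
    intro x
    have : Nonempty ({x} : Set V) := ⟨⟨x, rfl⟩⟩
    have : Subsingleton ({x} : Set V) := by
      rw [Set.subsingleton_coe]; exact Set.subsingleton_singleton
    exact SimpleGraph.Connected.of_subsingleton
  have hne : u ≠ w := h.ne
  have hP : 2 ≤ ({u, w} : Set V).ncard ∧ (G.induce ({u, w} : Set V)).Connected ∧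
      ∀ v ∈ ({u, w} : Set V), (G.induce (({u, w} : Set V) \ {v})).Connected := by
    refine ⟨(Set.ncard_pair hne).ge, induce_pair_connected_of_adj h, ?_⟩
    rintro v (rfl | rfl)
    · have : ({v, w} : Set V) \ {v} = {w} := by
        ext x; simp only [Set.mem_sdiff, Set.mem_insert_iff, Set.mem_singleton_iff]; grind
      rw [this]; exact hs w
    · have : ({u, v} : Set V) \ {v} = {u} := by
        ext x; simp only [Set.mem_sdiff, Set.mem_insert_iff, Set.mem_singleton_iff]; grind
      rw [this]; exact hs u
  obtain ⟨B, hB, hmax⟩ := (Set.toFinite {A : Set V | 2 ≤ A.ncard ∧ (G.induce A).Connected ∧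
    ∀ v ∈ A, (G.induce (A \ {v})).Connected}).exists_le_maximal hP
  exact ⟨B, hmax, hB (by simp), hB (by simp)⟩

lemma patch_of_connected {G : SimpleGraph V} {s t : Set V} {u y : V} (hc : (G.induce t).Connected)
    (hts : t ⊆ s) (hu : u ∈ t) (hy : y ∈ t) :
    ∃ s' ⊆ s, ∃ (hu' : u ∈ s') (hv' : y ∈ s'), (G.induce s').Reachable ⟨u, hu'⟩ ⟨y, hv'⟩ :=
  ⟨t, hts, hu, hy, hc.preconnected _ _⟩

lemma block_unique [Finite V] (G : SimpleGraph V) {u : V} (hu : ¬ IsCutVertex G u)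
    {B₁ B₂ : Set V} (h₁ : IsBlock G B₁) (h₂ : IsBlock G B₂) (hu₁ : u ∈ B₁) (hu₂ : u ∈ B₂) :
    B₁ = B₂ := by
  classical
  have hc : (G.induce {w | w ≠ u}).Connected := not_not.mp hu
  obtain ⟨⟨hn₁, hc₁, hd₁⟩, hm₁⟩ := h₁
  obtain ⟨⟨hn₂, hc₂, hd₂⟩, hm₂⟩ := h₂
  obtain ⟨b₁, hb₁, hbu₁⟩ := Set.exists_ne_of_one_lt_ncard hn₁ u
  obtain ⟨b₂, hb₂, hbu₂⟩ := Set.exists_ne_of_one_lt_ncard hn₂ u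
  obtain ⟨p, hp, hpu⟩ : ∃ p : G.Walk b₁ b₂, p.IsPath ∧ u ∉ p.support := by
    obtain ⟨q⟩ := hc.preconnected ⟨b₁, hbu₁⟩ ⟨b₂, hbu₂⟩
    let q' : G.Walk b₁ b₂ := q.map (Embedding.induce {w | w ≠ u}).toHom
    have hq' : u ∉ q'.support := by
      intro h
      have h' := h
      erw [Walk.support_map] at h'
      obtain ⟨a, -, ha⟩ := List.mem_map.1 h'
      exact a.2 ha
    exact ⟨q'.bypass, q'.bypass_isPath, fun h => hq' (q'.support_bypass_subset_support h)⟩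
  set P : Set V := {x | x ∈ p.support} with hPdef
  have hPc : (G.induce P).Connected := p.connected_induce_support
  have hb₁P : b₁ ∈ P := p.start_mem_support
  have hb₂P : b₂ ∈ P := p.end_mem_support
  have key : 2 ≤ (B₁ ∪ P ∪ B₂).ncard ∧ (G.induce (B₁ ∪ P ∪ B₂)).Connected ∧
      ∀ v ∈ (B₁ ∪ P ∪ B₂), (G.induce ((B₁ ∪ P ∪ B₂) \ {v})).Connected := by
    refine ⟨hn₁.trans (Set.ncard_le_ncard (fun x hx => Or.inl (Or.inl hx)) (Set.toFinite _)),
      ?_, ?_⟩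
    · exact union_conn (union_conn hc₁ hPc ⟨b₁, hb₁, hb₁P⟩)
        hc₂ ⟨u, Or.inl hu₁, hu₂⟩
    · intro v hv
      by_cases hvu : v = u
      · subst hvu
        have : (B₁ ∪ P ∪ B₂) \ {v} = ((B₁ \ {v}) ∪ P) ∪ (B₂ \ {v}) := by
          ext x
          have : x = v → x ∉ P := by rintro rfl; exact hpu
          simp only [Set.mem_sdiff, Set.mem_union, Set.mem_singleton_iff]; tauto
        rw [this]
        exact union_conn
          (union_conn (hd₁ v hu₁) hPc ⟨b₁, ⟨hb₁, hbu₁⟩, hb₁P⟩)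
          (hd₂ v hu₂) ⟨b₂, Or.inr hb₂P, hb₂, hbu₂⟩
      · have hE₁ : (G.induce (B₁ \ {v})).Connected := by
          by_cases h : v ∈ B₁
          · exact hd₁ v h
          · rwa [Set.sdiff_singleton_eq_self h]
        have hE₂ : (G.induce (B₂ \ {v})).Connected := by
          by_cases h : v ∈ B₂
          · exact hd₂ v h
          · rwa [Set.sdiff_singleton_eq_self h]
        have huv : u ≠ v := fun h => hvu h.symm
        refine induce_connected_of_patches u ⟨Or.inl (Or.inl hu₁), huv⟩ ?_
        rintro y ⟨(hy | hy) | hy, hyv⟩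
        · exact patch_of_connected hE₁ (fun x hx => ⟨Or.inl (Or.inl hx.1), hx.2⟩)
            ⟨hu₁, huv⟩ ⟨hy, hyv⟩
        · have hy' : y ∈ p.support := hy
          by_cases hv1 : v ∈ (p.takeUntil y hy').support
          · have hv2 : v ∉ (p.dropUntil y hy').support := by
              intro hv2
              have hnd := hp.support_nodup
              rw [← p.take_spec hy', Walk.support_append, List.nodup_append] at hnd
              rw [Walk.mem_support_iff] at hv2
              rcases hv2 with hv2 | hv2
              · exact hyv hv2.symm
              · exact hnd.2.2 v hv1 v hv2 rfl
            refine patch_of_connected (union_conn hE₂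
              (p.dropUntil y hy').connected_induce_support
              ⟨b₂, ⟨hb₂, ?_⟩, Walk.end_mem_support _⟩) ?_ (Or.inl ⟨hu₂, huv⟩)
              (Or.inr (Walk.start_mem_support _))
            · rintro rfl; exact hv2 (Walk.end_mem_support _)
            · rintro x (hx | hx)
              · exact ⟨Or.inr hx.1, hx.2⟩
              · exact ⟨Or.inl (Or.inr (p.support_dropUntil_subset_support hy' hx)),
                  by rintro rfl; exact hv2 hx⟩
          · refine patch_of_connected (union_conn hE₁
              (p.takeUntil y hy').connected_induce_support
              ⟨b₁, ⟨hb₁, ?_⟩, Walk.start_mem_support _⟩) ?_ (Or.inl ⟨hu₁, huv⟩)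
              (Or.inr (Walk.end_mem_support _))
            · rintro rfl; exact hv1 (Walk.start_mem_support _)
            · rintro x (hx | hx)
              · exact ⟨Or.inl (Or.inl hx.1), hx.2⟩
              · exact ⟨Or.inl (Or.inr (p.support_takeUntil_subset_support hy' hx)),
                  by rintro rfl; exact hv1 hx⟩
        · exact patch_of_connected hE₂ (fun x hx => ⟨Or.inr hx.1, hx.2⟩)
            ⟨hu₂, huv⟩ ⟨hy, hyv⟩
  have e₁ : B₁ ∪ P ∪ B₂ ⊆ B₁ := hm₁ key (fun x hx => Or.inl (Or.inl hx))
  have e₂ : B₁ ∪ P ∪ B₂ ⊆ B₂ := hm₂ key (fun x hx => Or.inr hx)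
  exact Set.Subset.antisymm (fun x hx => e₂ (Or.inl (Or.inl hx))) (fun x hx => e₁ (Or.inr hx))

lemma degree_le_blocks [Finite V] (G : SimpleGraph V) (u : V) :
    (G.neighborSet u).ncard ≤ (maxBlockSize G - 1) * blockDegree G u := by
  classical
  have hfin : {B : Set V | IsBlock G B ∧ u ∈ B}.Finite := Set.toFinite _
  have hsub : G.neighborSet u ⊆ ⋃ B ∈ hfin.toFinset, (B \ {u}) := by
    intro w hw
    obtain ⟨B, hB, huB, hwB⟩ := edge_block G hw
    simp only [Set.mem_iUnion]
    exact ⟨B, by simpa using ⟨hB, huB⟩, hwB, hw.ne'⟩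
  have hbdd : BddAbove {n | ∃ B, IsBlock G B ∧ B.ncard = n} := by
    refine ⟨(Set.univ : Set V).ncard, ?_⟩
    rintro n ⟨B, -, rfl⟩
    exact Set.ncard_le_ncard (Set.subset_univ _) (Set.toFinite _)
  calc (G.neighborSet u).ncard ≤ (⋃ B ∈ hfin.toFinset, (B \ {u})).ncard :=
        Set.ncard_le_ncard hsub (Set.toFinite _)
    _ ≤ ∑ B ∈ hfin.toFinset, (B \ {u}).ncard := Finset.set_ncard_biUnion_le _ _
    _ ≤ hfin.toFinset.card • (maxBlockSize G - 1) := by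
        refine Finset.sum_le_card_nsmul _ _ _ fun B hB => ?_
        obtain ⟨hB, huB⟩ : IsBlock G B ∧ u ∈ B := by simpa using hB
        rw [Set.ncard_sdiff_singleton_of_mem huB]
        exact Nat.sub_le_sub_right (le_csSup hbdd ⟨B, hB, rfl⟩) 1
    _ = (maxBlockSize G - 1) * blockDegree G u := by
        rw [blockDegree, Set.ncard_eq_toFinset_card _ hfin, smul_eq_mul, mul_comm]

/-- For a connected graph `G` with at least one cut-vertex, maximum block
size `β` and maximum number `Δ̃` of blocks through a cut-vertex, `Γ(G) ≤ (β − 1)Δ̃ + 1`. -/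
theorem statement_9 [Fintype V] (G : SimpleGraph V) (hconn : G.Connected)
    (hcut : ∃ v, IsCutVertex G v) :
    grundyNumber G ≤ (maxBlockSize G - 1) * maxCutBlockDegree G + 1 := by
  classical
  refine csSup_le' ?_
  rintro k ⟨c, -, hproper, hsurj, hgr⟩
  by_cases hk : k ≤ 1
  · omega
  push Not at hk
  obtain ⟨u, hcu⟩ := hsurj k (by simp; omega)
  have hdeg : k - 1 ≤ (G.neighborSet u).ncard := by
    have hs : (↑(Finset.Ico 1 k) : Set ℕ) ⊆ c '' G.neighborSet u := by
      intro i hi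
      obtain ⟨w, hw, hwi⟩ := hgr u i (by rw [hcu]; exact_mod_cast hi)
      exact ⟨w, hw, hwi⟩
    calc k - 1 = (↑(Finset.Ico 1 k) : Set ℕ).ncard := by rw [Set.ncard_coe_finset]; simp
      _ ≤ (c '' G.neighborSet u).ncard := Set.ncard_le_ncard hs (Set.toFinite _)
      _ ≤ _ := Set.ncard_image_le (Set.toFinite _)
  have hbdd : BddAbove {n | ∃ v, IsCutVertex G v ∧ blockDegree G v = n} := by
    refine ((Set.finite_range (blockDegree G)).subset ?_).bddAbove
    rintro n ⟨v, -, rfl⟩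
    exact ⟨v, rfl⟩
  have hle : blockDegree G u ≤ maxCutBlockDegree G := by
    by_cases hu : IsCutVertex G u
    · exact le_csSup hbdd ⟨u, hu, rfl⟩
    · have h1 : blockDegree G u ≤ 1 := by
        refine (Set.ncard_le_one (Set.toFinite _)).2 ?_
        intro A hA B hB
        exact block_unique G hu hA.1 hB.1 hA.2 hB.2
      obtain ⟨v, hv⟩ := hcut
      have h2 : 1 ≤ blockDegree G v := by
        obtain ⟨w, hw, -⟩ := hgr u 1 (by simp; omega)
        have : Nontrivial V := ⟨u, w, hw.ne⟩
        obtain ⟨x, hx⟩ := hconn.preconnected.exists_adj_of_nontrivial v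
        obtain ⟨B, hB, hvB, -⟩ := edge_block G hx
        exact (Set.ncard_pos (Set.toFinite _)).2 ⟨B, hB, hvB⟩
      exact h1.trans (h2.trans (le_csSup hbdd ⟨v, hv, rfl⟩))
  have := hdeg.trans ((degree_le_blocks G u).trans (Nat.mul_le_mul_left _ hle))
  omega
end

section
/- Let G be a finite simple graph, let c be a Grundy coloring of G with k colors, and let u be a vertex with c(u) = k. Let H be an induced subgraph of G of minimum cardinality such that u ∈ V(H) and the restriction of c to V(H) is a Grundy coloring of H with k colors. Then V(H) ⊆ B(u, k−1) ⊆ B(u, d_G(u)); moreover, either V(H) ⊆ B(u, Δ(u)), or there exists a neighbor w of u with V(H) ⊆ B(w, Δ(w)). -/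
open SimpleGraph

variable {V : Type*}

lemma gball_step (G : SimpleGraph V) {a x v : V} {n m : ℕ} (hx : x ∈ gball G a n)
    (h : G.Adj x v) (hm : n + 1 ≤ m) : v ∈ gball G a m := by
  obtain ⟨h1, h2⟩ := hx
  refine ⟨h1.trans h.reachable, ?_⟩
  obtain ⟨p, hp⟩ := h1.exists_walk_length_eq_dist
  have := SimpleGraph.dist_le (p.concat h)
  rw [SimpleGraph.Walk.length_concat] at this
  omega

lemma gball_mono (G : SimpleGraph V) (a : V) {n m : ℕ} (h : n ≤ m) :
    gball G a n ⊆ gball G a m := fun _ hx => ⟨hx.1, hx.2.trans h⟩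

lemma le_maxSmall [Fintype V] (G : SimpleGraph V) {a b : V} (h : G.Adj a b)
    (hd : deg G b ≤ deg G a) : deg G b ≤ maxSmallNbrDeg G a := by
  refine le_csSup ⟨deg G a, ?_⟩ ⟨b, h, hd, rfl⟩
  rintro d ⟨v, _, h1, h2⟩
  omega

/-- Lower bound on the degree from the colors seen in the neighborhood. -/
lemma le_deg_of_colors [Fintype V] (G : SimpleGraph V) (c : V → ℕ) (a : V) (T : Finset ℕ)
    (h : ∀ i ∈ T, ∃ w, G.Adj a w ∧ c w = i) : T.card ≤ deg G a := by
  classical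
  have h1 : (T : Set ℕ) ⊆ c '' (G.neighborSet a) := by
    intro i hi
    obtain ⟨w, h1, h2⟩ := h i hi
    exact ⟨w, h1, h2⟩
  calc T.card = (T : Set ℕ).ncard := (Set.ncard_coe_finset T).symm
    _ ≤ (c '' (G.neighborSet a)).ncard := Set.ncard_le_ncard h1 (Set.toFinite _)
    _ ≤ _ := Set.ncard_image_le (Set.toFinite _)

/-- If `c` is a Grundy coloring of `G` with `k` colors, `c(u) = k` and `S`
is a minimum-cardinality vertex set containing `u` whose induced restriction of `c` is a
Grundy coloring with `k` colors, then `S ⊆ B(u, k−1) ⊆ B(u, d(u))`, and moreover either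
`S ⊆ B(u, Δ(u))` or `S ⊆ B(w, Δ(w))` for some neighbor `w` of `u`. -/
theorem statement_10 [Fintype V] (G : SimpleGraph V) (c : V → ℕ) (k : ℕ)
    (hc : IsGrundyColoring G c k) (u : V) (hu : c u = k) (S : Set V)
    (huS : u ∈ S) (hSc : IsGrundyColoring (G.induce S) (fun x : S => c x) k)
    (hmin : ∀ S' : Set V, u ∈ S' → IsGrundyColoring (G.induce S') (fun x : S' => c x) k →
      S.ncard ≤ S'.ncard) :
    S ⊆ gball G u (k - 1) ∧ gball G u (k - 1) ⊆ gball G u (deg G u) ∧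
      (S ⊆ gball G u (maxSmallNbrDeg G u) ∨
        ∃ w, G.Adj u w ∧ S ⊆ gball G w (maxSmallNbrDeg G w)) := by
  classical
  obtain ⟨hr, hp, hne, hg⟩ := hc
  have hrange : ∀ v, 1 ≤ c v ∧ c v ≤ k := fun v => Finset.mem_Icc.1 (hr v)
  have hk : 1 ≤ k := hu ▸ (hrange u).1
  have hS : ∀ v ∈ S, ∀ i, 1 ≤ i → i < c v → ∃ w ∈ S, G.Adj v w ∧ c w = i := by
    intro v hv i h1 h2
    obtain ⟨w, h3, h4⟩ := hSc.2.2.2 ⟨v, hv⟩ i (Finset.mem_Ico.2 ⟨h1, h2⟩)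
    exact ⟨w, w.2, h3, h4⟩
  have key : ∀ S' : Set V, S' ⊆ S → u ∈ S' →
      (∀ v ∈ S', ∀ i, 1 ≤ i → i < c v → ∃ w ∈ S', G.Adj v w ∧ c w = i) → S' = S := by
    intro S' hsub huS' hcl
    refine Set.eq_of_subset_of_ncard_le hsub (hmin S' huS' ⟨fun v => hr v, ?_, ?_, ?_⟩)
      (Set.toFinite _)
    · intro x y hxy
      exact hp hxy
    · intro i hi
      obtain ⟨h1, h2⟩ := Finset.mem_Icc.1 hi
      rcases h2.eq_or_lt with h | h
      · exact ⟨⟨u, huS'⟩, hu.trans h.symm⟩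
      · obtain ⟨w, hw, _, h4⟩ := hcl u huS' i h1 (by omega)
        exact ⟨⟨w, hw⟩, h4⟩
    · intro v i hi
      obtain ⟨h1, h2⟩ := Finset.mem_Ico.1 hi
      obtain ⟨w, hw, h3, h4⟩ := hcl v v.2 i h1 h2
      exact ⟨⟨w, hw⟩, h3, h4⟩
  have hup : ∀ v ∈ S, v ≠ u → ∃ x ∈ S, G.Adj x v ∧ c v < c x := by
    intro v hv hvu
    by_contra hcon
    push Not at hcon
    have : S \ {v} = S := by
      refine key _ Set.sdiff_subset ⟨huS, fun h => hvu h.symm⟩ ?_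
      rintro x ⟨hx, hxv⟩ i h1 h2
      obtain ⟨w, hw, h3, h4⟩ := hS x hx i h1 h2
      refine ⟨w, ⟨hw, ?_⟩, h3, h4⟩
      rintro rfl
      have := hcon x hx h3
      omega
    have h2 : v ∈ S \ {v} := by rw [this]; exact hv
    exact h2.2 rfl
  have htop : ∀ v ∈ S, c v = k → v = u := by
    intro v hv h
    by_contra hne
    obtain ⟨x, _, _, h2⟩ := hup v hv hne
    have := (hrange x).2
    omega
  have hball : ∀ n, ∀ v ∈ S, k - c v = n → v ∈ gball G u n := by
    intro n
    induction n using Nat.strong_induction_on with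
    | _ n ih =>
      intro v hv hn
      by_cases hvu : v = u
      · subst hvu; exact mem_gball_self G _ _
      · obtain ⟨x, hx, h1, h2⟩ := hup v hv hvu
        have := (hrange x).2
        exact gball_step G (ih (k - c x) (by omega) x hx rfl) h1 (by omega)
  have hB1 : S ⊆ gball G u (k - 1) := fun v hv =>
    gball_mono G u (by have := (hrange v).1; omega) (hball _ v hv rfl)
  have hdu : k - 1 ≤ deg G u := by
    have := le_deg_of_colors G c u (Finset.Ico 1 k) (fun i hi => hg u i (by rw [hu]; exact hi))
    simpa using this
  refine ⟨hB1, gball_mono G u hdu, ?_⟩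
  rcases hk.eq_or_lt with hk1 | hk2
  · left
    exact hB1.trans (gball_mono G u (by omega))
  obtain ⟨w, hwS, huw, hcw⟩ := hS u huS (k - 1) (by omega) (by omega)
  have hdw : k - 1 ≤ deg G w := by
    have := le_deg_of_colors G c w (insert k (Finset.Ico 1 (k - 1))) (by
      intro i hi
      rcases Finset.mem_insert.1 hi with h | h
      · exact ⟨u, huw.symm, by omega⟩
      · exact hg w i (by rw [hcw]; exact h))
    rw [Finset.card_insert_of_notMem (by simp), Nat.card_Ico] at this
    omega
  rcases le_or_gt (deg G w) (deg G u) with hle | hlt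
  · left
    exact hB1.trans (gball_mono G u (hdw.trans (le_maxSmall G huw hle)))
  right
  refine ⟨w, huw, ?_⟩
  refine Set.Subset.trans ?_ (gball_mono G w (hdu.trans (le_maxSmall G huw.symm hlt.le)))
  have huniq : ∀ v ∈ S, c v = k - 1 → v = w := by
    have : {x | x ∈ S ∧ (c x = k - 1 → x = w)} = S := by
      refine key _ (fun x hx => hx.1) ⟨huS, fun h => by omega⟩ ?_
      rintro v ⟨hv, _⟩ i h1 h2
      by_cases hi : i = k - 1
      · have hvu : v = u := htop v hv (by have := (hrange v).2; omega)
        subst hvu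
        exact ⟨w, ⟨hwS, fun _ => rfl⟩, huw, by omega⟩
      · obtain ⟨y, hy, h3, h4⟩ := hS v hv i h1 h2
        exact ⟨y, ⟨hy, fun h => by omega⟩, h3, h4⟩
    intro v hv
    rw [← this] at hv
    exact hv.2
  have hu1 : u ∈ gball G w 1 := gball_step G (mem_gball_self G w 0) huw.symm (by omega)
  have hballw : ∀ n, ∀ v ∈ S, v ≠ u → k - c v = n → v ∈ gball G w n := by
    intro n
    induction n using Nat.strong_induction_on with
    | _ n ih =>
      intro v hv hvu hn
      by_cases hvw : v = w
      · subst hvw; exact mem_gball_self G _ _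
      · have h5 : c v ≠ k - 1 := fun h => hvw (huniq v hv h)
        have h6 : c v ≠ k := fun h => hvu (htop v hv h)
        have h7 := (hrange v).2
        obtain ⟨x, hx, h1, h2⟩ := hup v hv hvu
        have := (hrange x).2
        by_cases hxu : x = u
        · subst hxu
          exact gball_step G hu1 h1 (by omega)
        · exact gball_step G (ih (k - c x) (by omega) x hx hxu rfl) h1 (by omega)
  intro v hv
  by_cases hvu : v = u
  · subst hvu
    exact gball_mono G w (by omega) hu1
  · exact gball_mono G w (by have := (hrange v).1; omega) (hballw _ v hv hvu rfl)
end

section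
/- Let G be a finite simple graph with at least one vertex. Then Γ(G) = max_{v ∈ V(G)} Γ(G(v)) = max_{v ∈ V(G)} Γ_{G(v)}(v), where G(v) denotes the subgraph of G induced by the ball B(v, Δ(v)). -/
open SimpleGraph

variable {V : Type*}

/-- Partial Grundy coloring; color `0` means uncolored. -/
def PGrundy {W : Type*} (H : SimpleGraph W) (c : W → ℕ) : Prop :=
  (∀ x y, H.Adj x y → c x ≠ 0 → c x ≠ c y) ∧
  (∀ v i, 1 ≤ i → i < c v → ∃ w, H.Adj v w ∧ c w = i)

lemma IsGrundyColoring.pGrundy {W : Type*} {H : SimpleGraph W} {c : W → ℕ} {k : ℕ}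
    (h : IsGrundyColoring H c k) : PGrundy H c :=
  ⟨fun _ _ hxy _ => h.2.1 hxy, fun v i h1 h2 => h.2.2.2 v i (Finset.mem_Ico.2 ⟨h1, h2⟩)⟩

lemma PGrundy.extend {W : Type*} [Finite W] (H : SimpleGraph W) (n : ℕ) : ∀ (c : W → ℕ),
    PGrundy H c → {v | c v = 0}.ncard = n →
    ∃ c', PGrundy H c' ∧ (∀ v, c' v ≠ 0) ∧ ∀ v, c v ≠ 0 → c' v = c v := by
  classical
  induction n with
  | zero =>
    intro c hc h0
    refine ⟨c, hc, fun v hv => ?_, fun _ _ => rfl⟩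
    rw [Set.ncard_eq_zero] at h0
    have : v ∈ {v | c v = 0} := hv
    rw [h0] at this
    exact this
  | succ n ih =>
    intro c hc hn
    obtain ⟨v, hv⟩ : {v | c v = 0}.Nonempty := by
      rw [← Set.ncard_pos]; omega
    have hv0 : c v = 0 := hv
    have hex : ∃ j, 1 ≤ j ∧ ∀ w, H.Adj v w → c w ≠ j := by
      obtain ⟨M, hM⟩ := (Set.finite_range c).bddAbove
      refine ⟨M + 1, by omega, fun w _ hw => ?_⟩
      have := hM ⟨w, rfl⟩
      omega
    let m := Nat.find hex
    have hm := Nat.find_spec hex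
    have hmin : ∀ i, 1 ≤ i → i < m → ∃ w, H.Adj v w ∧ c w = i := by
      intro i h1 h2
      have := Nat.find_min hex h2
      push Not at this
      exact this h1
    have hne : ∀ w, w ≠ v → Function.update c v m w = c w := fun w hw => by
      simp [Function.update, hw]
    have hup : Function.update c v m v = m := by simp
    have hm1 : 1 ≤ m := hm.1
    have hm2 : ∀ w, H.Adj v w → c w ≠ m := hm.2
    obtain ⟨c', h1, h2, h3⟩ := ih (Function.update c v m) (by
      constructor
      · intro x y hxy hx
        by_cases h : x = v
        · subst h
          rw [hup, hne y hxy.ne']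
          exact (hm2 y hxy).symm
        · rw [hne x h] at hx ⊢
          by_cases h' : y = v
          · subst h'
            rw [hup]
            exact hm2 x hxy.symm
          · rw [hne y h']
            exact hc.1 x y hxy hx
      · intro x i hi hx
        have key : ∃ w, H.Adj x w ∧ c w = i := by
          by_cases h : x = v
          · subst h
            rw [hup] at hx
            exact hmin i hi hx
          · rw [hne x h] at hx
            exact hc.2 x i hi hx
        obtain ⟨w, hw, hwi⟩ := key
        refine ⟨w, hw, ?_⟩
        rw [hne w (by rintro rfl; omega)]
        exact hwi) (by
      have : {w | Function.update c v m w = 0} = {w | c w = 0} \ {v} := by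
        ext w
        by_cases h : w = v
        · subst h; simp; omega
        · simp [h]
      rw [this, Set.ncard_diff_singleton_of_mem hv, hn]; rfl)
    refine ⟨c', h1, h2, fun w hw => ?_⟩
    have hwv : w ≠ v := by rintro rfl; exact hw hv0
    rw [h3 w (by rw [hne w hwv]; exact hw), hne w hwv]

lemma PGrundy.exists_full {W : Type*} [Finite W] (H : SimpleGraph W) (c : W → ℕ)
    (hc : PGrundy H c) : ∃ c' k, IsGrundyColoring H c' k ∧ ∀ v, c v ≠ 0 → c' v = c v := by
  obtain ⟨c', h1, h2, h3⟩ := PGrundy.extend H _ c hc rfl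
  cases nonempty_fintype W
  refine ⟨c', Finset.univ.sup c', ⟨?_, ?_, ?_, ?_⟩, h3⟩
  · intro v
    exact Finset.mem_Icc.2 ⟨Nat.one_le_iff_ne_zero.2 (h2 v), Finset.le_sup (Finset.mem_univ v)⟩
  · intro x y hxy
    exact h1.1 x y hxy (h2 x)
  · intro i hi
    rw [Finset.mem_Icc] at hi
    have hne : (Finset.univ : Finset W).Nonempty := by
      by_contra h
      rw [Finset.not_nonempty_iff_eq_empty] at h
      rw [h] at hi
      simp at hi
      omega
    obtain ⟨v, -, hv⟩ := Finset.exists_mem_eq_sup Finset.univ hne c'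
    rcases hi.2.eq_or_lt with h | h
    · exact ⟨v, by omega⟩
    · obtain ⟨w, -, hw⟩ := h1.2 v i hi.1 (by omega)
      exact ⟨w, hw⟩
  · intro v i hi
    rw [Finset.mem_Ico] at hi
    exact h1.2 v i hi.1 hi.2

lemma IsGrundyColoring.le_card {W : Type*} [Finite W] {H : SimpleGraph W} {c : W → ℕ} {k : ℕ}
    (h : IsGrundyColoring H c k) : k ≤ Nat.card W := by
  classical
  cases nonempty_fintype W
  have : Finset.Icc 1 k ⊆ Finset.univ.image c := by
    intro i hi
    obtain ⟨v, hv⟩ := h.2.2.1 i hi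
    exact Finset.mem_image.2 ⟨v, Finset.mem_univ v, hv⟩
  have h1 := Finset.card_le_card this
  have h2 := Finset.card_image_le (s := Finset.univ) (f := c)
  rw [Nat.card_Icc] at h1
  rw [Finset.card_univ] at h2
  rw [Nat.card_eq_fintype_card]
  omega

lemma bdd_grundyNumber {W : Type*} [Finite W] (H : SimpleGraph W) :
    BddAbove {k | ∃ c, IsGrundyColoring H c k} :=
  ⟨Nat.card W, fun _ ⟨_, h⟩ => h.le_card⟩

lemma bdd_grundyAt {W : Type*} [Finite W] (H : SimpleGraph W) (u : W) :
    BddAbove {j | ∃ c k, IsGrundyColoring H c k ∧ c u = j} :=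
  ⟨Nat.card W, fun _ ⟨_, _, h, hj⟩ =>
    hj ▸ (Finset.mem_Icc.1 (h.1 u)).2.trans h.le_card⟩

lemma PGrundy.le_grundyAt {W : Type*} [Finite W] {H : SimpleGraph W} {c : W → ℕ}
    (hc : PGrundy H c) (u : W) : c u ≤ grundyAt H u := by
  by_cases h : c u = 0
  · omega
  obtain ⟨c', k, h1, h2⟩ := PGrundy.exists_full H c hc
  exact le_csSup (bdd_grundyAt H u) ⟨c', k, h1, h2 u h⟩

lemma grundyAt_le {W : Type*} [Finite W] (H : SimpleGraph W) (u : W) :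
    grundyAt H u ≤ grundyNumber H := by
  apply csSup_le'
  rintro j ⟨c, k, h, rfl⟩
  exact (Finset.mem_Icc.1 (h.1 u)).2.trans (le_csSup (bdd_grundyNumber H) ⟨c, h⟩)

lemma grundyNumber_induce_le {W : Type*} [Finite W] (H : SimpleGraph W) (s : Set W) :
    grundyNumber (H.induce s) ≤ grundyNumber H := by
  classical
  apply csSup_le'
  rintro k ⟨c, h⟩
  rcases Nat.eq_zero_or_pos k with rfl | hk
  · exact Nat.zero_le _
  obtain ⟨v, hv⟩ := h.2.2.1 k (Finset.mem_Icc.2 ⟨hk, le_rfl⟩)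
  have hp : PGrundy H (fun x => if hx : x ∈ s then c ⟨x, hx⟩ else 0) := by
    constructor
    · intro x y hxy hx
      by_cases hxs : x ∈ s
      · by_cases hys : y ∈ s
        · simp only [hxs, hys, dif_pos]
          exact h.2.1 (by simpa using hxy)
        · simp only [hys, dif_neg, not_false_eq_true]
          exact hx
      · simp [hxs] at hx
    · intro x i hi hx
      by_cases hxs : x ∈ s
      · simp only [hxs, dif_pos] at hx
        obtain ⟨w, hw, hwi⟩ := h.2.2.2 ⟨x, hxs⟩ i (Finset.mem_Ico.2 ⟨hi, hx⟩)
        exact ⟨w, by simpa using hw, by simpa using hwi⟩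
      · simp [hxs] at hx
  have := (hp.le_grundyAt v.1).trans (grundyAt_le H v.1)
  simp only [v.2, dif_pos] at this
  have e : c ⟨v.1, v.2⟩ = k := hv
  omega

lemma PGrundy.le_ball {W : Type*} [Finite W] {H : SimpleGraph W} {c : W → ℕ}
    (hc : PGrundy H c) (v : W) (r : ℕ) (hr : c v ≤ r + 1) :
    c v ≤ grundyAt (H.induce (gball H v r)) ⟨v, mem_gball_self H v r⟩ := by
  classical
  let c' : gball H v r → ℕ := fun x => if H.dist v x.1 + c x.1 ≤ c v then c x.1 else 0
  have hp : PGrundy (H.induce (gball H v r)) c' := by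
    constructor
    · intro x y hxy hx
      have hadj : H.Adj x.1 y.1 := by simpa using hxy
      simp only [c'] at hx ⊢
      split_ifs at hx ⊢ with h1 h2
      · exact hc.1 _ _ hadj hx
      · exact hx
      all_goals simp at hx
    · intro x i hi hx
      simp only [c'] at hx
      split_ifs at hx with h1
      · obtain ⟨w, hw, hwi⟩ := hc.2 x.1 i hi hx
        have hreach : H.Reachable v w := x.2.1.trans hw.reachable
        have hd : H.dist v w ≤ H.dist v x.1 + 1 := by
          obtain ⟨p, hp⟩ := x.2.1.exists_walk_length_eq_dist
          have := SimpleGraph.dist_le (p.concat hw)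
          rw [SimpleGraph.Walk.length_concat] at this
          omega
        refine ⟨⟨w, hreach, by omega⟩, by simpa using hw, ?_⟩
        simp only [c']
        rw [if_pos (by omega)]
        exact hwi
      · omega
  have := hp.le_grundyAt ⟨v, mem_gball_self H v r⟩
  simpa [c'] using this

lemma PGrundy.le_deg {W : Type*} [Finite W] {H : SimpleGraph W} {c : W → ℕ}
    (hc : PGrundy H c) (v : W) : c v ≤ deg H v + 1 := by
  have hs : ((Finset.Ico 1 (c v) : Finset ℕ) : Set ℕ) ⊆ c '' H.neighborSet v := by
    intro i hi
    rw [Finset.mem_coe, Finset.mem_Ico] at hi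
    obtain ⟨w, hw, hwi⟩ := hc.2 v i hi.1 hi.2
    exact ⟨w, hw, hwi⟩
  have h1 := Set.ncard_le_ncard hs (Set.toFinite _)
  have h2 := Set.ncard_image_le (f := c) (Set.toFinite (H.neighborSet v))
  rw [Set.ncard_coe_finset, Nat.card_Ico] at h1
  unfold deg
  omega

lemma le_maxSmallNbrDeg {W : Type*} [Finite W] (H : SimpleGraph W) {u w : W} (h : H.Adj u w)
    (hd : deg H w ≤ deg H u) : deg H w ≤ maxSmallNbrDeg H u :=
  le_csSup ⟨deg H u, by rintro d ⟨v, -, h, rfl⟩; exact h⟩ ⟨w, h, hd, rfl⟩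

lemma exists_center {W : Type*} [Finite W] [Nonempty W] (H : SimpleGraph W) :
    ∃ v, grundyNumber H ≤ grundyAt (H.induce (gball H v (maxSmallNbrDeg H v)))
          ⟨v, mem_gball_self H v _⟩ := by
  classical
  have hmem : grundyNumber H ∈ {k | ∃ c, IsGrundyColoring H c k} := by
    apply Nat.sSup_mem _ (bdd_grundyNumber H)
    obtain ⟨c, k, h, -⟩ := PGrundy.exists_full H (fun _ => 0) ⟨by simp, by simp⟩
    exact ⟨k, c, h⟩
  obtain ⟨c, hc⟩ := hmem
  generalize grundyNumber H = k at hc ⊢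
  have hp := hc.pGrundy
  have hk : 1 ≤ k := by
    have := Finset.mem_Icc.1 (hc.1 (Classical.arbitrary W))
    omega
  obtain ⟨u, hu⟩ := hc.2.2.1 k (Finset.mem_Icc.2 ⟨hk, le_rfl⟩)
  rcases hk.eq_or_lt with h1 | h1
  · refine ⟨u, ?_⟩
    have := hp.le_ball u (maxSmallNbrDeg H u) (by omega)
    omega
  obtain ⟨w, hw, hwk⟩ := hp.2 u (k - 1) (by omega) (by omega)
  have hwu : w ≠ u := hw.ne'
  let c2 : W → ℕ := fun x => if x = u then k - 1 else if x = w then k else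
    if c x ≤ k - 2 then c x else 0
  have hu2 : c2 u = k - 1 := by simp [c2]
  have hw2 : c2 w = k := by simp [c2, hwu]
  have ho : ∀ x, x ≠ u → x ≠ w → c2 x = if c x ≤ k - 2 then c x else 0 := by
    intro x h1 h2
    simp [c2, h1, h2]
  have hsmall : ∀ x, c x ≤ k - 2 → c2 x = c x := by
    intro x hx
    rw [ho x (by rintro rfl; omega) (by rintro rfl; omega), if_pos hx]
  have hp2 : PGrundy H c2 := by
    constructor
    · intro x y hxy hx
      have hne := hxy.ne
      have hcne := hc.2.1 hxy
      by_cases hxu : x = u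
      · subst hxu
        by_cases hyw : y = w
        · subst hyw; omega
        · rw [ho y hne.symm hyw]
          split_ifs <;> omega
      by_cases hxw : x = w
      · subst hxw
        by_cases hyu : y = u
        · subst hyu; omega
        · rw [ho y hyu hne.symm]
          split_ifs <;> omega
      rw [ho x hxu hxw] at hx ⊢
      by_cases hyu : y = u
      · subst hyu; split_ifs <;> omega
      by_cases hyw : y = w
      · subst hyw; split_ifs <;> omega
      rw [ho y hyu hyw]
      split_ifs at hx ⊢ <;> omega
    · intro x i hi hx
      by_cases hxw : x = w ∧ i = k - 1
      · exact ⟨u, hxw.1 ▸ hw.symm, hu2.trans hxw.2.symm⟩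
      have key : i < c x ∧ i ≤ k - 2 := by
        by_cases hxu : x = u
        · subst hxu; omega
        by_cases hxw' : x = w
        · subst hxw'
          have : i ≠ k - 1 := fun h => hxw ⟨rfl, h⟩
          omega
        · rw [ho x hxu hxw'] at hx
          split_ifs at hx <;> omega
      obtain ⟨y, hy, hyi⟩ := hp.2 x i hi key.1
      exact ⟨y, hy, by rw [hsmall y (by omega)]; exact hyi⟩
  have du := hp.le_deg u
  have dw := hp2.le_deg w
  rcases le_total (deg H w) (deg H u) with h | h
  · have := le_maxSmallNbrDeg H hw h
    refine ⟨u, ?_⟩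
    have := hp.le_ball u (maxSmallNbrDeg H u) (by omega)
    omega
  · have := le_maxSmallNbrDeg H hw.symm h
    refine ⟨w, ?_⟩
    have := hp2.le_ball w (maxSmallNbrDeg H w) (by omega)
    omega

/-- `Γ(G) = max_{v} Γ(G(v)) = max_{v} Γ_{G(v)}(v)`, where
`G(v) = G[B(v, Δ(v))]`. -/
theorem statement_11 [Fintype V] [Nonempty V] (G : SimpleGraph V) :
    grundyNumber G = (⨆ v : V, grundyNumber (G.induce (gball G v (maxSmallNbrDeg G v)))) ∧
      grundyNumber G = ⨆ v : V,
        grundyAt (G.induce (gball G v (maxSmallNbrDeg G v)))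
          ⟨v, mem_gball_self G v _⟩ := by
  obtain ⟨v, hv⟩ := exists_center G
  have b1 : (⨆ v : V, grundyNumber (G.induce (gball G v (maxSmallNbrDeg G v)))) ≤
      grundyNumber G := ciSup_le fun v => grundyNumber_induce_le G _
  have b2 : (⨆ v : V, grundyAt (G.induce (gball G v (maxSmallNbrDeg G v)))
      ⟨v, mem_gball_self G v _⟩) ≤ grundyNumber G :=
    ciSup_le fun v => (grundyAt_le _ _).trans (grundyNumber_induce_le G _)
  refine ⟨le_antisymm ?_ b1, le_antisymm ?_ b2⟩
  · exact (hv.trans (grundyAt_le _ _)).trans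
      (le_ciSup (f := fun v : V => grundyNumber (G.induce (gball G v (maxSmallNbrDeg G v))))
        (Set.finite_range _).bddAbove v)
  · exact hv.trans
      (le_ciSup (f := fun v : V => grundyAt (G.induce (gball G v (maxSmallNbrDeg G v)))
        ⟨v, mem_gball_self G v _⟩) (Set.finite_range _).bddAbove v)
end

section
/- Let G be a finite simple graph, u a vertex of G, and c a Grundy coloring of G such that c(u) = k. Let H be an induced subgraph of G of minimum cardinality such that u ∈ V(H) and the restriction of c to V(H) is a Grundy coloring of H with k colors. Then V(H) ⊆ B(u, k−1), and at most one vertex of H is at distance exactly k−1 from u in G. -/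
open SimpleGraph

variable {V : Type*}

/-- If `c` is a Grundy coloring of `G` with `c(u) = k` and `S` is a
minimum-cardinality vertex set containing `u` whose induced restriction of `c` is a Grundy
coloring with `k` colors, then `S ⊆ B(u, k−1)` and at most one vertex of `S` is at distance
exactly `k−1` from `u`. -/
theorem statement_12 [Fintype V] (G : SimpleGraph V) (c : V → ℕ) (m : ℕ)
    (hc : IsGrundyColoring G c m) (u : V) (k : ℕ) (hu : c u = k) (S : Set V)
    (huS : u ∈ S) (hSc : IsGrundyColoring (G.induce S) (fun x : S => c x) k)
    (hmin : ∀ S' : Set V, u ∈ S' → IsGrundyColoring (G.induce S') (fun x : S' => c x) k →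
      S.ncard ≤ S'.ncard) :
    S ⊆ gball G u (k - 1) ∧
      ∀ v ∈ S, ∀ w ∈ S, G.dist u v = k - 1 → G.dist u w = k - 1 → v = w := by
  classical
  obtain ⟨h1, h2, -, h4⟩ := hSc
  have hw : ∀ (x : V) (i : ℕ), ∃ y, x ∈ S → 1 ≤ i → i < c x → y ∈ S ∧ G.Adj x y ∧ c y = i := by
    intro x i
    by_cases h : x ∈ S ∧ 1 ≤ i ∧ i < c x
    · obtain ⟨hx, hi, hi'⟩ := h
      obtain ⟨y, hy, hy'⟩ := h4 ⟨x, hx⟩ i (Finset.mem_Ico.2 ⟨hi, hi'⟩)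
      exact ⟨y.1, fun _ _ _ => ⟨y.2, hy, hy'⟩⟩
    · exact ⟨x, fun a b d => absurd ⟨a, b, d⟩ h⟩
  choose w hw using hw
  let f : V → V := fun x => w x (c x - 1)
  let T : Set V := {x | x ∈ S ∧ G.Reachable u x ∧ G.dist u x + c x ≤ k ∧
    (G.dist u x + c x = k → x = f^[G.dist u x] u)}
  have huT : u ∈ T := ⟨huS, Reachable.refl u, by simp [hu], by simp⟩
  have hclos : ∀ x ∈ T, ∀ i, 1 ≤ i → i < c x → w x i ∈ T ∧ G.Adj x (w x i) ∧ c (w x i) = i := by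
    rintro x ⟨hxS, hxr, hxk, hxe⟩ i hi hix
    obtain ⟨hyS, hadj, hcy⟩ := hw x i hxS hi hix
    refine ⟨?_, hadj, hcy⟩
    have hd : G.dist u (w x i) ≤ G.dist u x + 1 := by
      obtain ⟨p, hp⟩ := hxr.exists_walk_length_eq_dist
      have := SimpleGraph.dist_le (p.concat hadj)
      rw [Walk.length_concat, hp] at this
      exact this
    refine ⟨hyS, hxr.trans hadj.reachable, by omega, fun he => ?_⟩
    have e1 : G.dist u (w x i) = G.dist u x + 1 := by omega
    have e2 : i = c x - 1 := by omega
    have e3 := hxe (by omega)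
    rw [e1, Function.iterate_succ_apply', ← e3, e2]
  have hTG : IsGrundyColoring (G.induce T) (fun x : T => c x) k := by
    refine ⟨fun v => h1 ⟨v.1, v.2.1⟩, ?_, ?_, ?_⟩
    · intro x y hxy
      exact h2 (x := ⟨x.1, x.2.1⟩) (y := ⟨y.1, y.2.1⟩) hxy
    · intro i hi
      rw [Finset.mem_Icc] at hi
      rcases hi.2.eq_or_lt with h | h
      · exact ⟨⟨u, huT⟩, hu.trans h.symm⟩
      · obtain ⟨a, -, b⟩ := hclos u huT i hi.1 (by omega)
        exact ⟨⟨_, a⟩, b⟩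
    · intro x i hi
      rw [Finset.mem_Ico] at hi
      obtain ⟨a, b, d⟩ := hclos x.1 x.2 i hi.1 hi.2
      exact ⟨⟨_, a⟩, b, d⟩
  have hTS : T = S :=
    Set.eq_of_subset_of_ncard_le (fun x hx => hx.1) (hmin T huT hTG) (Set.toFinite S)
  have hpos : ∀ x ∈ S, 1 ≤ c x := fun x hx => (Finset.mem_Icc.1 (h1 ⟨x, hx⟩)).1
  have key : ∀ x ∈ S, G.dist u x = k - 1 → x = f^[k - 1] u := by
    intro x hx hd
    have hp := hpos x hx
    rw [← hTS] at hx
    obtain ⟨-, -, a, b⟩ := hx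
    rw [← hd]
    exact b (by omega)
  refine ⟨fun x hx => ?_, fun v hv x hx h h' => (key v hv h).trans (key x hx h').symm⟩
  have hp := hpos x hx
  rw [← hTS] at hx
  exact ⟨hx.2.1, by have := hx.2.2.1; omega⟩
end
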